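/- Let Λ be a family of n pseudoplanes in general position in ℝ³. There is an absolute constant C such that for every integer k with 1 ≤ k < n, the number of vertices of the arrangement of Λ at level k (equivalently, the number of k-corridors |C^k|) is at most C · n · k^{5/3}. -/

import Mathlib

open scoped Classical

noncomputable section

/-- A pseudoplane, identified with the total bivariate (curried) function whose graph it is. -/
abbrev PP : Type := ℝ → ℝ → ℝ

/-- `φ : ℝ → ℝ` is the continuous function whose graph is the xy-projection of the
intersection curve `γ_{a,b} = a ∩ b` of the pseudoplanes `a` and `b`. -/
def IsGraphFun (a b : PP) (φ : ℝ → ℝ) : Prop :=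
  Continuous φ ∧ ∀ x y : ℝ, a x y = b x y ↔ y = φ x

/-- A family of pseudoplanes in general position in ℝ³:
(1) each member is (the graph of) a continuous total bivariate function;
(2) the intersection of any two distinct members is the graph of a continuous
    function `φ_{a,b} : ℝ → ℝ` (a connected x-monotone unbounded curve);
(3) any three distinct members intersect in exactly one point;
(4) the xy-projections of the intersection curves form a family of pseudolines:
    for distinct pairs `{a,b} ≠ {c,d}`, `φ_{a,b}` and `φ_{c,d}` agree at exactly one point;
(5) no point is incident to more than three pseudoplanes;
(6) no two pseudoplanes are tangent (the difference changes sign);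
(7) no intersection curve of two pseudoplanes is tangent to a third pseudoplane
    (the relevant difference function takes both signs). -/
def PseudoplaneFamily (Λ : Finset PP) : Prop :=
  (∀ a ∈ Λ, Continuous fun q : ℝ × ℝ => a q.1 q.2) ∧
  (∀ a ∈ Λ, ∀ b ∈ Λ, a ≠ b → ∃ φ : ℝ → ℝ, IsGraphFun a b φ) ∧
  (∀ a ∈ Λ, ∀ b ∈ Λ, ∀ c ∈ Λ, a ≠ b → a ≠ c → b ≠ c →
    ∃! q : ℝ × ℝ, a q.1 q.2 = b q.1 q.2 ∧ a q.1 q.2 = c q.1 q.2) ∧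
  (∀ a ∈ Λ, ∀ b ∈ Λ, ∀ c ∈ Λ, ∀ d ∈ Λ, a ≠ b → c ≠ d → ({a, b} : Finset PP) ≠ {c, d} →
    ∀ φ ψ : ℝ → ℝ, IsGraphFun a b φ → IsGraphFun c d ψ → ∃! x : ℝ, φ x = ψ x) ∧
  (∀ a ∈ Λ, ∀ b ∈ Λ, ∀ c ∈ Λ, ∀ d ∈ Λ, a ≠ b → a ≠ c → a ≠ d → b ≠ c → b ≠ d → c ≠ d →
    ¬ ∃ x y : ℝ, a x y = b x y ∧ a x y = c x y ∧ a x y = d x y) ∧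
  (∀ a ∈ Λ, ∀ b ∈ Λ, a ≠ b → (∃ x y : ℝ, a x y < b x y) ∧ (∃ x y : ℝ, b x y < a x y)) ∧
  (∀ a ∈ Λ, ∀ b ∈ Λ, ∀ c ∈ Λ, a ≠ b → a ≠ c → b ≠ c → ∀ φ : ℝ → ℝ, IsGraphFun a b φ →
    (∃ x : ℝ, c x (φ x) < a x (φ x)) ∧ (∃ x : ℝ, a x (φ x) < c x (φ x)))

/-- The level of the point `(x, y, z)`: the number of members of `Λ` passing strictly below it. -/
def level (Λ : Finset PP) (x y z : ℝ) : ℕ :=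
  (Λ.filter fun a => a x y < z).card

/-- The triple `s = {a,b,c}` spans a `k`-corridor: its common (triple intersection) point
is at level `k`. -/
def IsKCorridorTriple (Λ : Finset PP) (k : ℕ) (s : Finset PP) : Prop :=
  ∃ x y z : ℝ, (∀ a ∈ s, a x y = z) ∧ level Λ x y z = k

/-- The set `C^k` of `k`-corridors, encoded by the 3-element subsets of `Λ` spanning them. -/
def kCorridors (Λ : Finset PP) (k : ℕ) : Finset (Finset PP) :=
  (Λ.powersetCard 3).filter (IsKCorridorTriple Λ k)

/-- The corridor of a triple `s`: the open region strictly between the lower and the upper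
envelope of the three surfaces in `s`. Points of ℝ³ are `(x, (y, z))`. -/
def corridorSet (s : Finset PP) : Set (ℝ × ℝ × ℝ) :=
  {p | (∃ a ∈ s, a p.1 p.2.1 < p.2.2) ∧ (∃ a ∈ s, p.2.2 < a p.1 p.2.1)}

/-- The common intersection curve of the members of `s`. -/
def curveSet (s : Finset PP) : Set (ℝ × ℝ × ℝ) :=
  {p | ∀ a ∈ s, a p.1 p.2.1 = p.2.2}

/-- The corridor spanned by `s₁` is immersed in the corridor spanned by `s₂`: they share
exactly one pseudoplane, and the intersection curve of the other two pseudoplanes of `s₁`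
is fully contained in the corridor of `s₂`. -/
def Immersed (s₁ s₂ : Finset PP) : Prop :=
  (s₁ ∩ s₂).card = 1 ∧ curveSet (s₁ \ s₂) ⊆ corridorSet s₂

/-- `X^k`: the number of ordered pairs of `k`-corridors such that the first is immersed
in the second. -/
def numImmersedPairs (Λ : Finset PP) (k : ℕ) : ℕ :=
  ((kCorridors Λ k ×ˢ kCorridors Λ k).filter fun q => Immersed q.1 q.2).card

namespace PPk

/-- A continuous function with a unique zero, taking both signs, has constant signs on both sides. -/
theorem sign_change (g : ℝ → ℝ) (hg : Continuous g) (x0 : ℝ) (h0 : ∀ x, g x = 0 → x = x0)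
    (hn : ∃ x, g x < 0) (hp : ∃ x, 0 < g x) :
    ((∀ x < x0, g x < 0) ∧ (∀ x > x0, 0 < g x)) ∨
    ((∀ x < x0, 0 < g x) ∧ (∀ x > x0, g x < 0)) := by
  have key : ∀ x y, g x < 0 → 0 < g y → x0 ∈ Set.uIcc x y := by
    intro x y hx hy
    have h := intermediate_value_uIcc (f := g) (a := x) (b := y) hg.continuousOn
    have hm : (0 : ℝ) ∈ Set.uIcc (g x) (g y) := by
      rw [Set.mem_uIcc]; left; constructor <;> linarith
    obtain ⟨z, hz, hz0⟩ := h hm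
    rw [← h0 z hz0]; exact hz
  have tri : ∀ x, x ≠ x0 → g x < 0 ∨ 0 < g x := by
    intro x hx
    rcases lt_trichotomy (g x) 0 with h | h | h
    · exact Or.inl h
    · exact absurd (h0 x h) hx
    · exact Or.inr h
  obtain ⟨u, hu⟩ := hn
  obtain ⟨v, hv⟩ := hp
  have h1 := key u v hu hv
  by_cases huv : u ≤ v
  · left
    rw [Set.uIcc_of_le huv] at h1
    constructor
    · intro x hx
      rcases tri x hx.ne with h | h
      · exact h
      · have h2 := key u x hu h
        have h3 : u ≠ x0 := by
          rintro rfl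
          have h4 := key (min x u) u
          by_contra
          have hgu : g u ≠ 0 := by linarith
          -- choose the zero of g
          have hm : (0 : ℝ) ∈ Set.uIcc (g u) (g v) := by
            rw [Set.mem_uIcc]; left; constructor <;> linarith
          obtain ⟨z, hz, hz0⟩ := intermediate_value_uIcc (f := g) (a := u) (b := v)
            hg.continuousOn hm
          have := h0 z hz0
          rw [this] at hz0; linarith
        rcases Set.mem_uIcc.1 h2 with h5 | h5
        · linarith [h5.2]
        · exact absurd (le_antisymm h1.1 h5.2) h3
    · intro x hx
      rcases tri x hx.ne' with h | h
      · have h2 := key x v h hv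
        have h3 : v ≠ x0 := by
          rintro rfl
          have hm : (0 : ℝ) ∈ Set.uIcc (g u) (g v) := by
            rw [Set.mem_uIcc]; left; constructor <;> linarith
          obtain ⟨z, hz, hz0⟩ := intermediate_value_uIcc (f := g) (a := u) (b := v)
            hg.continuousOn hm
          have := h0 z hz0
          rw [this] at hz0; linarith
        rcases Set.mem_uIcc.1 h2 with h5 | h5
        · linarith [h5.1]
        · exact absurd (le_antisymm h5.1 h1.2) h3
      · exact h
  · right
    push Not at huv
    rw [Set.uIcc_of_ge huv.le] at h1
    have hz : g x0 = 0 := by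
      have hm : (0 : ℝ) ∈ Set.uIcc (g u) (g v) := by
        rw [Set.mem_uIcc]; left; constructor <;> linarith
      obtain ⟨z, hz, hz0⟩ := intermediate_value_uIcc (f := g) (a := u) (b := v)
        hg.continuousOn hm
      have := h0 z hz0
      rw [this] at hz0; exact hz0
    constructor
    · intro x hx
      rcases tri x hx.ne with h | h
      · have h2 := key x v h hv
        have h3 : v ≠ x0 := by rintro rfl; linarith
        rcases Set.mem_uIcc.1 h2 with h5 | h5
        · exact absurd (le_antisymm h1.1 h5.2) h3
        · linarith [h5.2]
      · exact h
    · intro x hx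
      rcases tri x hx.ne' with h | h
      · exact h
      · have h2 := key u x hu h
        have h3 : u ≠ x0 := by rintro rfl; linarith
        rcases Set.mem_uIcc.1 h2 with h5 | h5
        · exact absurd (le_antisymm h5.1 h1.2) h3
        · linarith [h5.1]

structure Fam (α : Type) where
  s : α → ℝ → ℝ → ℝ
  phi : α → α → ℝ → ℝ
  s_cont : ∀ a, Continuous fun q : ℝ × ℝ => s a q.1 q.2
  phi_cont : ∀ a b, a ≠ b → Continuous (phi a b)
  phi_iff : ∀ a b, a ≠ b → ∀ x y, s a x y = s b x y ↔ y = phi a b x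
  tri : ∀ a b c, a ≠ b → a ≠ c → b ≠ c →
    ∃! q : ℝ × ℝ, s a q.1 q.2 = s b q.1 q.2 ∧ s a q.1 q.2 = s c q.1 q.2
  cross : ∀ a b c d, a ≠ b → c ≠ d → a ≠ c → a ≠ d → b ≠ c → b ≠ d →
    ∃! x, phi a b x = phi c d x
  four : ∀ a b c d, a ≠ b → a ≠ c → a ≠ d → b ≠ c → b ≠ d → c ≠ d →
    ∀ x y, s a x y = s b x y → s a x y = s c x y → s a x y = s d x y → False
  two : ∀ a b, a ≠ b → ∃ x y, s a x y < s b x y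
  three : ∀ a b c, a ≠ b → a ≠ c → b ≠ c →
    (∃ x, s c x (phi a b x) < s a x (phi a b x)) ∧ (∃ x, s a x (phi a b x) < s c x (phi a b x))

namespace Fam

variable {α : Type} (F : Fam α)

theorem phi_comm {a b : α} (h : a ≠ b) : F.phi a b = F.phi b a := by
  funext x
  have h1 := (F.phi_iff a b h x (F.phi a b x)).2 rfl
  exact (F.phi_iff b a h.symm x _).1 h1.symm

theorem s_phi {a b : α} (h : a ≠ b) (x : ℝ) :
    F.s a x (F.phi a b x) = F.s b x (F.phi a b x) :=
  (F.phi_iff a b h x _).2 rfl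

/-- `a` is below `b` for large `y`. -/
def prec (a b : α) : Prop :=
  a ≠ b ∧ ∀ x y, (F.phi a b x < y → F.s a x y < F.s b x y) ∧
    (y < F.phi a b x → F.s b x y < F.s a x y)

theorem const_sign {a b : α} (h : a ≠ b) (e : ℝ) (he : e = 1 ∨ e = -1) :
    (∀ x t, 0 < t → F.s a x (F.phi a b x + e * t) < F.s b x (F.phi a b x + e * t)) ∨
    (∀ x t, 0 < t → F.s b x (F.phi a b x + e * t) < F.s a x (F.phi a b x + e * t)) := by
  set g : ℝ × ℝ → ℝ := fun q =>
    F.s a q.1 (F.phi a b q.1 + e * q.2) - F.s b q.1 (F.phi a b q.1 + e * q.2) with hgdef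
  have hm : Continuous fun q : ℝ × ℝ => (q.1, F.phi a b q.1 + e * q.2) := by
    have := F.phi_cont a b h
    fun_prop
  have hg : Continuous g := by
    exact ((F.s_cont a).comp hm).sub ((F.s_cont b).comp hm)
  have hS : IsPreconnected {q : ℝ × ℝ | 0 < q.2} := by
    apply Convex.isPreconnected
    have : {q : ℝ × ℝ | 0 < q.2} = Set.univ ×ˢ Set.Ioi 0 := by ext; simp
    rw [this]
    exact convex_univ.prod (convex_Ioi 0)
  have hne : ∀ q : ℝ × ℝ, 0 < q.2 → g q ≠ 0 := by
    intro q hq h0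
    have h1 : F.s a q.1 (F.phi a b q.1 + e * q.2) = F.s b q.1 (F.phi a b q.1 + e * q.2) :=
      sub_eq_zero.1 h0
    have h2 := (F.phi_iff a b h _ _).1 h1
    have : e * q.2 = 0 := by linarith
    rcases he with rfl | rfl <;> linarith
  by_contra hcon
  push Not at hcon
  obtain ⟨⟨x, t, ht, h1⟩, ⟨x', t', ht', h2⟩⟩ := hcon
  have hiv := hS.intermediate_value (f := g) (a := (x', t')) (b := (x, t)) ht' ht hg.continuousOn
  have h0 : (0 : ℝ) ∈ Set.Icc (g (x', t')) (g (x, t)) := by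
    constructor
    · simp only [hgdef]; linarith
    · simp only [hgdef]; linarith
  obtain ⟨q, hq, hq0⟩ := hiv h0
  exact hne q hq hq0

theorem prec_total {a b : α} (h : a ≠ b) : F.prec a b ∨ F.prec b a := by
  have h1 := F.const_sign h 1 (Or.inl rfl)
  have h2 := F.const_sign h (-1) (Or.inr rfl)
  obtain ⟨x1, y1, hxy1⟩ := F.two a b h
  obtain ⟨x2, y2, hxy2⟩ := F.two b a h.symm
  have up : ∀ {P : ℝ → ℝ → Prop}, (∀ x t, 0 < t → P x (F.phi a b x + 1 * t)) →
      ∀ x y, F.phi a b x < y → P x y := by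
    intro P hP x y hy
    have := hP x (y - F.phi a b x) (by linarith)
    simpa using this
  have dn : ∀ {P : ℝ → ℝ → Prop}, (∀ x t, 0 < t → P x (F.phi a b x + (-1) * t)) →
      ∀ x y, y < F.phi a b x → P x y := by
    intro P hP x y hy
    have := hP x (F.phi a b x - y) (by linarith)
    simpa using this
  have tr : ∀ x y, y ≠ F.phi a b x → F.phi a b x < y ∨ y < F.phi a b x :=
    fun x y hy => (lt_or_gt_of_ne hy).symm
  have hne1 : y1 ≠ F.phi a b x1 := fun h' => by
    have := (F.phi_iff a b h x1 y1).2 h'; linarith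
  have hne2 : y2 ≠ F.phi a b x2 := fun h' => by
    have := (F.phi_iff a b h x2 y2).2 h'; linarith
  rcases h1 with h1 | h1 <;> rcases h2 with h2 | h2
  · exfalso
    rcases tr x2 y2 hne2 with h3 | h3
    · have := up (P := fun x y => F.s a x y < F.s b x y) h1 x2 y2 h3; linarith
    · have := dn (P := fun x y => F.s a x y < F.s b x y) h2 x2 y2 h3; linarith
  · left
    exact ⟨h, fun x y => ⟨up (P := fun x y => F.s a x y < F.s b x y) h1 x y,
      dn (P := fun x y => F.s b x y < F.s a x y) h2 x y⟩⟩
  · right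
    refine ⟨h.symm, fun x y => ?_⟩
    rw [← F.phi_comm h]
    exact ⟨up (P := fun x y => F.s b x y < F.s a x y) h1 x y,
      dn (P := fun x y => F.s a x y < F.s b x y) h2 x y⟩
  · exfalso
    rcases tr x1 y1 hne1 with h3 | h3
    · have := up (P := fun x y => F.s b x y < F.s a x y) h1 x1 y1 h3; linarith
    · have := dn (P := fun x y => F.s b x y < F.s a x y) h2 x1 y1 h3; linarith

variable {F} in
theorem prec.lt_iff {a b : α} (h : F.prec a b) (x y : ℝ) :
    F.s a x y < F.s b x y ↔ F.phi a b x < y := by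
  refine ⟨fun h1 => ?_, (h.2 x y).1⟩
  by_contra h2
  rcases lt_or_eq_of_le (not_lt.1 h2) with h3 | h3
  · have := (h.2 x y).2 h3; linarith
  · have := (F.phi_iff a b h.1 x y).2 h3; linarith

variable {F} in
theorem prec.gt_iff {a b : α} (h : F.prec a b) (x y : ℝ) :
    F.s b x y < F.s a x y ↔ y < F.phi a b x := by
  refine ⟨fun h1 => ?_, (h.2 x y).2⟩
  by_contra h2
  rcases lt_or_eq_of_le (not_lt.1 h2) with h3 | h3
  · have := (h.2 x y).1 h3; linarith
  · have := (F.phi_iff a b h.1 x y).2 h3.symm; linarith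

theorem prec_asymm {a b : α} (h : F.prec a b) (h' : F.prec b a) : False := by
  have h1 := (h.lt_iff 0 (max (F.phi a b 0) (F.phi b a 0) + 1)).2
    (by linarith [le_max_left (F.phi a b 0) (F.phi b a 0)])
  have h2 := (h'.lt_iff 0 (max (F.phi a b 0) (F.phi b a 0) + 1)).2
    (by linarith [le_max_right (F.phi a b 0) (F.phi b a 0)])
  linarith

theorem prec_trans {a b c : α} (h : F.prec a b) (h' : F.prec b c) : F.prec a c := by
  have hac : a ≠ c := by
    rintro rfl; exact F.prec_asymm h h'
  rcases F.prec_total hac with h3 | h3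
  · exact h3
  · exfalso
    set M := max (F.phi a b 0) (max (F.phi b c 0) (F.phi c a 0)) with hM
    have e1 : F.phi a b 0 ≤ M := le_max_left _ _
    have e2 : F.phi b c 0 ≤ M := (le_max_left _ _).trans (le_max_right _ _)
    have e3 : F.phi c a 0 ≤ M := (le_max_right _ _).trans (le_max_right _ _)
    have h1 := (h.lt_iff 0 (M + 1)).2 (by linarith)
    have h2 := (h'.lt_iff 0 (M + 1)).2 (by linarith)
    have h4 := (h3.lt_iff 0 (M + 1)).2 (by linarith)
    linarith

/-- The triple point (projection). -/
def pt (a b c : α) : ℝ × ℝ :=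
  if h : ∃ q : ℝ × ℝ, F.s a q.1 q.2 = F.s b q.1 q.2 ∧ F.s a q.1 q.2 = F.s c q.1 q.2
  then h.choose else 0

theorem pt_spec {a b c : α} (hab : a ≠ b) (hac : a ≠ c) (hbc : b ≠ c) :
    F.s a (F.pt a b c).1 (F.pt a b c).2 = F.s b (F.pt a b c).1 (F.pt a b c).2 ∧
    F.s a (F.pt a b c).1 (F.pt a b c).2 = F.s c (F.pt a b c).1 (F.pt a b c).2 := by
  have h := (F.tri a b c hab hac hbc).exists
  unfold pt
  rw [dif_pos h]
  exact h.choose_spec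

theorem pt_unique {a b c : α} (hab : a ≠ b) (hac : a ≠ c) (hbc : b ≠ c) {x y : ℝ}
    (h1 : F.s a x y = F.s b x y) (h2 : F.s a x y = F.s c x y) : (x, y) = F.pt a b c :=
  (F.tri a b c hab hac hbc).unique (y₁ := (x, y)) ⟨h1, h2⟩ (F.pt_spec hab hac hbc)

theorem pt_swap12 {a b c : α} (hab : a ≠ b) (hac : a ≠ c) (hbc : b ≠ c) :
    F.pt a b c = F.pt b a c := by
  have h := F.pt_spec hab hac hbc
  exact F.pt_unique hab.symm hbc hac h.1.symm (h.1.symm.trans h.2)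

theorem pt_swap23 {a b c : α} (hab : a ≠ b) (hac : a ≠ c) (hbc : b ≠ c) :
    F.pt a b c = F.pt a c b := by
  have h := F.pt_spec hab hac hbc
  exact F.pt_unique hac hab hbc.symm h.2 h.1

/-- x-coordinate of the triple point. -/
def T (a b c : α) : ℝ := (F.pt a b c).1

theorem T_swap12 {a b c : α} (hab : a ≠ b) (hac : a ≠ c) (hbc : b ≠ c) :
    F.T a b c = F.T b a c := by unfold T; rw [F.pt_swap12 hab hac hbc]

theorem T_swap23 {a b c : α} (hab : a ≠ b) (hac : a ≠ c) (hbc : b ≠ c) :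
    F.T a b c = F.T a c b := by unfold T; rw [F.pt_swap23 hab hac hbc]

theorem pt_snd {a b c : α} (hab : a ≠ b) (hac : a ≠ c) (hbc : b ≠ c) :
    (F.pt a b c).2 = F.phi a b (F.T a b c) :=
  (F.phi_iff a b hab _ _).1 (F.pt_spec hab hac hbc).1

theorem s_T {a b c : α} (hab : a ≠ b) (hac : a ≠ c) (hbc : b ≠ c) :
    F.s a (F.T a b c) (F.phi a b (F.T a b c)) = F.s c (F.T a b c) (F.phi a b (F.T a b c)) := by
  have := (F.pt_spec hab hac hbc).2
  rw [F.pt_snd hab hac hbc] at this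
  exact this

theorem T_unique {a b c : α} (hab : a ≠ b) (hac : a ≠ c) (hbc : b ≠ c) {x : ℝ}
    (h : F.s a x (F.phi a b x) = F.s c x (F.phi a b x)) : x = F.T a b c := by
  have := F.pt_unique hab hac hbc (F.s_phi hab x) h
  unfold T; rw [← this]

/-- Along the curve `a ∩ b`, `c` goes from below to above. -/
def Up (a b c : α) : Prop :=
  (∀ x < F.T a b c, F.s c x (F.phi a b x) < F.s a x (F.phi a b x)) ∧
  (∀ x > F.T a b c, F.s a x (F.phi a b x) < F.s c x (F.phi a b x))

/-- Along the curve `a ∩ b`, `c` goes from above to below. -/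
def Dn (a b c : α) : Prop :=
  (∀ x < F.T a b c, F.s a x (F.phi a b x) < F.s c x (F.phi a b x)) ∧
  (∀ x > F.T a b c, F.s c x (F.phi a b x) < F.s a x (F.phi a b x))

theorem W_cont {a b : α} (hab : a ≠ b) (c : α) : Continuous fun x => F.s c x (F.phi a b x) := by
  have hm : Continuous fun x : ℝ => (x, F.phi a b x) := by
    have := F.phi_cont a b hab
    fun_prop
  exact (F.s_cont c).comp hm

theorem up_or_dn {a b c : α} (hab : a ≠ b) (hac : a ≠ c) (hbc : b ≠ c) :
    F.Up a b c ∨ F.Dn a b c := by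
  have h3 := F.three a b c hab hac hbc
  have := sign_change (fun x => F.s c x (F.phi a b x) - F.s a x (F.phi a b x))
    ((F.W_cont hab c).sub (F.W_cont hab a)) (F.T a b c)
    (fun x hx => F.T_unique hab hac hbc (by linarith))
    (by obtain ⟨x, hx⟩ := h3.1; exact ⟨x, by linarith⟩)
    (by obtain ⟨x, hx⟩ := h3.2; exact ⟨x, by linarith⟩)
  rcases this with h | h
  · left
    exact ⟨fun x hx => by have := h.1 x hx; linarith,
      fun x hx => by have := h.2 x hx; linarith⟩
  · right
    exact ⟨fun x hx => by have := h.1 x hx; linarith,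
      fun x hx => by have := h.2 x hx; linarith⟩

theorem up_dn_false {a b c : α} (h : F.Up a b c) (h' : F.Dn a b c) : False := by
  have h1 := h.1 (F.T a b c - 1) (by linarith)
  have h2 := h'.1 (F.T a b c - 1) (by linarith)
  linarith

/-- Sign facts along a curve, `Up` case. -/
theorem up_lt_iff {a b c : α} (hab : a ≠ b) (hac : a ≠ c) (hbc : b ≠ c) (h : F.Up a b c) (x : ℝ) :
    F.s c x (F.phi a b x) < F.s a x (F.phi a b x) ↔ x < F.T a b c := by
  refine ⟨fun h1 => ?_, h.1 x⟩
  rcases lt_trichotomy x (F.T a b c) with h2 | h2 | h2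
  · exact h2
  · subst h2; have := F.s_T hab hac hbc; linarith
  · have := h.2 x h2; linarith

theorem up_gt_iff {a b c : α} (hab : a ≠ b) (hac : a ≠ c) (hbc : b ≠ c) (h : F.Up a b c) (x : ℝ) :
    F.s a x (F.phi a b x) < F.s c x (F.phi a b x) ↔ F.T a b c < x := by
  refine ⟨fun h1 => ?_, h.2 x⟩
  rcases lt_trichotomy x (F.T a b c) with h2 | h2 | h2
  · have := h.1 x h2; linarith
  · subst h2; have := F.s_T hab hac hbc; linarith
  · exact h2

theorem dn_lt_iff {a b c : α} (hab : a ≠ b) (hac : a ≠ c) (hbc : b ≠ c) (h : F.Dn a b c) (x : ℝ) :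
    F.s c x (F.phi a b x) < F.s a x (F.phi a b x) ↔ F.T a b c < x := by
  refine ⟨fun h1 => ?_, h.2 x⟩
  rcases lt_trichotomy x (F.T a b c) with h2 | h2 | h2
  · have := h.1 x h2; linarith
  · subst h2; have := F.s_T hab hac hbc; linarith
  · exact h2

theorem dn_gt_iff {a b c : α} (hab : a ≠ b) (hac : a ≠ c) (hbc : b ≠ c) (h : F.Dn a b c) (x : ℝ) :
    F.s a x (F.phi a b x) < F.s c x (F.phi a b x) ↔ x < F.T a b c := by
  refine ⟨fun h1 => ?_, h.1 x⟩
  rcases lt_trichotomy x (F.T a b c) with h2 | h2 | h2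
  · exact h2
  · subst h2; have := F.s_T hab hac hbc; linarith
  · have := h.2 x h2; linarith

end Fam

end PPk

namespace PPk

section sampling
variable {α : Type}

def wt (p : ℝ) (V R : Finset α) : ℝ := (∏ _i ∈ R, p) * ∏ _i ∈ V \ R, (1 - p)

theorem wt_nonneg {p : ℝ} (h0 : 0 ≤ p) (h1 : p ≤ 1) (V R : Finset α) : 0 ≤ wt p V R := by
  unfold wt
  apply mul_nonneg <;> apply Finset.prod_nonneg <;> intros <;> linarith

theorem wt_ind (p : ℝ) (V D K : Finset α) (hD : D ⊆ V) (hK : K ⊆ V) (hDK : Disjoint D K) :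
    ∑ R ∈ V.powerset, wt p V R * (if D ⊆ R ∧ Disjoint K R then 1 else 0) =
      p ^ D.card * (1 - p) ^ K.card := by
  have h := Finset.prod_add (fun i => if i ∈ K then (0:ℝ) else p)
    (fun i => if i ∈ D then (0:ℝ) else 1 - p) V
  have e1 : ∀ R ∈ V.powerset, wt p V R * (if D ⊆ R ∧ Disjoint K R then 1 else 0) =
      (∏ i ∈ R, if i ∈ K then (0:ℝ) else p) * ∏ i ∈ V \ R, (if i ∈ D then (0:ℝ) else 1 - p) := by
    intro R hR
    by_cases hc : D ⊆ R ∧ Disjoint K R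
    · rw [if_pos hc, mul_one]
      unfold wt
      congr 1
      · apply Finset.prod_congr rfl
        intro i hi
        rw [if_neg (fun hk => (Finset.disjoint_left.1 hc.2 hk) hi)]
      · apply Finset.prod_congr rfl
        intro i hi
        rw [if_neg (fun hk => (Finset.mem_sdiff.1 hi).2 (hc.1 hk))]
    · rw [if_neg hc, mul_zero]
      rw [not_and_or] at hc
      rcases hc with hc | hc
      · obtain ⟨i, hi, hiR⟩ := Finset.not_subset.1 hc
        rw [Finset.prod_eq_zero (i := i) (s := V \ R) (Finset.mem_sdiff.2 ⟨hD hi, hiR⟩)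
          (by rw [if_pos hi]), mul_zero]
      · obtain ⟨i, hi, hiR⟩ := Finset.not_disjoint_iff.1 hc
        rw [Finset.prod_eq_zero (i := i) (s := R) hiR (by rw [if_pos hi]), zero_mul]
  rw [Finset.sum_congr rfl e1, ← h]
  have e2 : ∀ i ∈ V, ((if i ∈ K then (0:ℝ) else p) + if i ∈ D then (0:ℝ) else 1 - p) =
      (if i ∈ D then p else 1) * (if i ∈ K then 1 - p else 1) := by
    intro i _
    by_cases hd : i ∈ D
    · have hk : i ∉ K := Finset.disjoint_left.1 hDK hd
      simp [hd, hk]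
    · by_cases hk : i ∈ K <;> simp [hd, hk]
  rw [Finset.prod_congr rfl e2, Finset.prod_mul_distrib]
  congr 1
  · rw [← Finset.prod_filter, Finset.filter_mem_eq_inter, Finset.inter_eq_right.2 hD,
      Finset.prod_const]
  · rw [← Finset.prod_filter, Finset.filter_mem_eq_inter, Finset.inter_eq_right.2 hK,
      Finset.prod_const]

theorem wt_one (p : ℝ) (V : Finset α) : ∑ R ∈ V.powerset, wt p V R = 1 := by
  have := wt_ind p V ∅ ∅ (by simp) (by simp) (by simp)
  simpa using this

theorem wt_card (p : ℝ) (V : Finset α) :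
    ∑ R ∈ V.powerset, wt p V R * (R.card : ℝ) = p * V.card := by
  have e : ∀ R ∈ V.powerset, wt p V R * (R.card : ℝ) =
      ∑ i ∈ V, wt p V R * (if ({i} : Finset α) ⊆ R ∧ Disjoint (∅ : Finset α) R then 1 else 0) := by
    intro R hR
    rw [← Finset.mul_sum]
    congr 1
    simp only [Finset.singleton_subset_iff, Finset.disjoint_empty_left, and_true]
    rw [Finset.sum_boole, Finset.filter_mem_eq_inter,
      Finset.inter_eq_right.2 (Finset.mem_powerset.1 hR)]
  rw [Finset.sum_congr rfl e, Finset.sum_comm]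
  rw [Finset.sum_congr rfl (fun i hi => wt_ind p V {i} ∅ (by simpa using hi) (by simp) (by simp))]
  simp [mul_comm]

theorem wt_count {ι : Type} (p : ℝ) (V : Finset α) (τ : Finset ι) (D K : ι → Finset α)
    (hD : ∀ t ∈ τ, D t ⊆ V) (hK : ∀ t ∈ τ, K t ⊆ V) (hDK : ∀ t ∈ τ, Disjoint (D t) (K t)) :
    ∑ R ∈ V.powerset, wt p V R * ((τ.filter fun t => D t ⊆ R ∧ Disjoint (K t) R).card : ℝ) =
      ∑ t ∈ τ, p ^ (D t).card * (1 - p) ^ (K t).card := by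
  have e : ∀ R ∈ V.powerset,
      wt p V R * ((τ.filter fun t => D t ⊆ R ∧ Disjoint (K t) R).card : ℝ) =
      ∑ t ∈ τ, wt p V R * (if D t ⊆ R ∧ Disjoint (K t) R then 1 else 0) := by
    intro R hR
    rw [← Finset.mul_sum, Finset.sum_boole]
  rw [Finset.sum_congr rfl e, Finset.sum_comm]
  exact Finset.sum_congr rfl (fun t ht => wt_ind p V _ _ (hD t ht) (hK t ht) (hDK t ht))

theorem clarkson_shor {ι : Type} (V : Finset α) (τ : Finset ι) (D K : ι → Finset α)
    (hD : ∀ t ∈ τ, D t ⊆ V) (hK : ∀ t ∈ τ, K t ⊆ V) (hDK : ∀ t ∈ τ, Disjoint (D t) (K t))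
    (k : ℕ) (hk : 1 ≤ k) (hD2 : ∀ t ∈ τ, (D t).card = 2) (hKk : ∀ t ∈ τ, (K t).card ≤ k)
    (A B : ℝ)
    (hR : ∀ R ⊆ V, ((τ.filter fun t => D t ⊆ R ∧ Disjoint (K t) R).card : ℝ) ≤ A * R.card + B) :
    (τ.card : ℝ) ≤ 4 * k * A * V.card + 8 * k ^ 2 * B := by
  have hk' : (1 : ℝ) ≤ k := by exact_mod_cast hk
  set p : ℝ := 1 / (2 * k) with hp
  have hp0 : 0 < p := by positivity
  have hpk : p * k = 1 / 2 := by rw [hp]; field_simp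
  have hp1 : p ≤ 1 / 2 := by nlinarith
  have h1 := wt_count p V τ D K hD hK hDK
  have h2 : ∑ R ∈ V.powerset, wt p V R * ((τ.filter fun t => D t ⊆ R ∧ Disjoint (K t) R).card : ℝ)
      ≤ A * (p * V.card) + B := by
    calc _ ≤ ∑ R ∈ V.powerset, wt p V R * (A * R.card + B) := by
          apply Finset.sum_le_sum
          intro R hRV
          exact mul_le_mul_of_nonneg_left (hR R (Finset.mem_powerset.1 hRV))
            (wt_nonneg hp0.le (by linarith) _ _)
      _ = A * (∑ R ∈ V.powerset, wt p V R * (R.card : ℝ)) + B * ∑ R ∈ V.powerset, wt p V R := by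
          rw [Finset.mul_sum, Finset.mul_sum, ← Finset.sum_add_distrib]
          apply Finset.sum_congr rfl
          intros; ring
      _ = _ := by rw [wt_card, wt_one, mul_one]
  have hb : (1 : ℝ) / 2 ≤ (1 - p) ^ k := by
    have := one_add_mul_le_pow (a := -p) (by linarith) k
    have e : (1 + -p) = 1 - p := by ring
    rw [e] at this
    nlinarith
  have h3 : (τ.card : ℝ) * (p ^ 2 * (1 / 2)) ≤ ∑ t ∈ τ, p ^ (D t).card * (1 - p) ^ (K t).card := by
    rw [← nsmul_eq_mul]
    apply Finset.card_nsmul_le_sum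
    intro t ht
    rw [hD2 t ht]
    apply mul_le_mul_of_nonneg_left _ (by positivity)
    refine hb.trans ?_
    exact pow_le_pow_of_le_one (by linarith) (by linarith) (hKk t ht)
  have h4 : (τ.card : ℝ) * (p ^ 2 * (1 / 2)) ≤ A * (p * V.card) + B := by
    rw [h1] at h2; linarith
  have h5 : (τ.card : ℝ) * (p ^ 2 * (1 / 2)) * (8 * k ^ 2) ≤
      (A * (p * V.card) + B) * (8 * k ^ 2) := mul_le_mul_of_nonneg_right h4 (by positivity)
  have e1 : (τ.card : ℝ) * (p ^ 2 * (1 / 2)) * (8 * k ^ 2) = τ.card * (4 * (p * k) ^ 2) := by ring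
  have e2 : (A * (p * V.card) + B) * (8 * k ^ 2) =
      8 * A * V.card * (p * k) * k + 8 * k ^ 2 * B := by ring
  rw [e1, e2, hpk] at h5
  linarith

theorem amplify {ι κ : Type} (V : Finset α) (E : Finset ι) (M : Finset κ)
    (De : ι → Finset α) (Dm : κ → Finset α)
    (hE : ∀ t ∈ E, De t ⊆ V) (hM : ∀ t ∈ M, Dm t ⊆ V)
    (hE2 : ∀ t ∈ E, (De t).card = 2) (hM4 : ∀ t ∈ M, (Dm t).card = 4)
    (hR : ∀ R ⊆ V, ((E.filter fun t => De t ⊆ R).card : ℝ) ≤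
      4 * R.card + ((M.filter fun t => Dm t ⊆ R).card : ℝ))
    (p : ℝ) (hp0 : 0 < p) (hp1 : p ≤ 1) :
    p ^ 2 * E.card ≤ 4 * p * V.card + p ^ 4 * M.card := by
  have h1 := wt_count p V E De (fun _ => ∅) hE (by simp) (by simp)
  have h2 := wt_count p V M Dm (fun _ => ∅) hM (by simp) (by simp)
  simp only [Finset.disjoint_empty_left, and_true, Finset.card_empty, pow_zero, mul_one] at h1 h2
  have q1 : ∑ t ∈ E, p ^ (De t).card = E.card * p ^ 2 := by
    calc _ = ∑ t ∈ E, p ^ 2 := Finset.sum_congr rfl (fun t ht => by rw [hE2 t ht])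
      _ = _ := by rw [Finset.sum_const, nsmul_eq_mul]
  have q2 : ∑ t ∈ M, p ^ (Dm t).card = M.card * p ^ 4 := by
    calc _ = ∑ t ∈ M, p ^ 4 := Finset.sum_congr rfl (fun t ht => by rw [hM4 t ht])
      _ = _ := by rw [Finset.sum_const, nsmul_eq_mul]
  rw [q1] at h1
  rw [q2] at h2
  have h3 : ∑ R ∈ V.powerset, wt p V R * ((E.filter fun t => De t ⊆ R).card : ℝ) ≤
      ∑ R ∈ V.powerset, wt p V R * (4 * R.card + ((M.filter fun t => Dm t ⊆ R).card : ℝ)) := by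
    apply Finset.sum_le_sum
    intro R hRV
    exact mul_le_mul_of_nonneg_left (hR R (Finset.mem_powerset.1 hRV))
      (wt_nonneg hp0.le hp1 _ _)
  have h4 : ∑ R ∈ V.powerset, wt p V R * (4 * R.card + ((M.filter fun t => Dm t ⊆ R).card : ℝ)) =
      4 * (p * V.card) + M.card * p ^ 4 := by
    rw [← h2, ← wt_card, Finset.mul_sum, ← Finset.sum_add_distrib]
    apply Finset.sum_congr rfl
    intros; ring
  have h5 : ∑ R ∈ V.powerset, wt p V R * ((E.filter fun t => De t ⊆ R).card : ℝ) =
      E.card * p ^ 2 := by rw [h1]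
  rw [h5, h4] at h3
  linarith

end sampling

/-- Walk lemma: signed number of steps across level `j`. -/
theorem walk {α : Type} (κ : α → ℝ) (σ : α → Prop) (j : ℕ) (m : ℕ) :
    ∀ (A : Finset α) (c : ℕ), A.card = m → (Set.InjOn κ A) →
    ((A.filter fun a => σ a ∧ c + (A.filter fun b => σ b ∧ κ b < κ a).card +
        (A.filter fun b => ¬ σ b ∧ κ a < κ b).card = j).card : ℤ) -
    ((A.filter fun a => ¬ σ a ∧ c + (A.filter fun b => σ b ∧ κ b < κ a).card +
        (A.filter fun b => ¬ σ b ∧ κ a < κ b).card = j).card : ℤ) =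
    (if j < c + (A.filter fun a => σ a).card then 1 else 0) -
    (if j < c + (A.filter fun a => ¬ σ a).card then 1 else 0) := by
  induction m with
  | zero =>
    intro A c hA _
    rw [Finset.card_eq_zero] at hA
    subst hA; simp
  | succ m ih =>
    intro A c hA hinj
    have hne : A.Nonempty := Finset.card_pos.1 (by omega)
    obtain ⟨t, htA, htmax⟩ := A.exists_max_image κ hne
    set B := A.erase t with hB
    have hAB : A = insert t B := (Finset.insert_erase htA).symm
    have htB : t ∉ B := Finset.notMem_erase t A
    have hlt : ∀ b ∈ B, κ b < κ t := by
      intro b hb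
      have hbA := Finset.mem_of_mem_erase hb
      refine lt_of_le_of_ne (htmax b hbA) (fun h => ?_)
      exact Finset.ne_of_mem_erase hb (hinj hbA htA h)
    have hBc : B.card = m := by rw [hB, Finset.card_erase_of_mem htA, hA]; rfl
    have hBinj : Set.InjOn κ B := hinj.mono (by
      intro x hx; exact Finset.mem_of_mem_erase hx)
    have f1 : ∀ a ∈ B, (A.filter fun b => σ b ∧ κ b < κ a) = B.filter fun b => σ b ∧ κ b < κ a := by
      intro a ha
      rw [hAB, Finset.filter_insert, if_neg]
      rintro ⟨-, h⟩; exact absurd (hlt a ha) (not_lt.2 h.le)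
    have f2 : (A.filter fun b => σ b ∧ κ b < κ t) = B.filter fun b => σ b := by
      rw [hAB, Finset.filter_insert, if_neg (by simp)]
      apply Finset.filter_congr
      intro b hb; simp [hlt b hb]
    have f3 : (A.filter fun b => ¬ σ b ∧ κ t < κ b) = ∅ := by
      apply Finset.filter_eq_empty_iff.2
      rintro b hb ⟨-, h⟩
      exact absurd (htmax b hb) (not_le.2 h)
    by_cases hs : σ t
    · have f4 : ∀ a ∈ B, (A.filter fun b => ¬ σ b ∧ κ a < κ b) =
          B.filter fun b => ¬ σ b ∧ κ a < κ b := by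
        intro a ha
        rw [hAB, Finset.filter_insert, if_neg]
        rintro ⟨h, -⟩; exact h hs
      have ihB := ih B c hBc hBinj
      have g1 : (A.filter fun a => σ a ∧ c + (A.filter fun b => σ b ∧ κ b < κ a).card +
          (A.filter fun b => ¬ σ b ∧ κ a < κ b).card = j).card =
          (B.filter fun a => σ a ∧ c + (B.filter fun b => σ b ∧ κ b < κ a).card +
          (B.filter fun b => ¬ σ b ∧ κ a < κ b).card = j).card +
          (if c + (B.filter fun b => σ b).card = j then 1 else 0) := by
        conv_lhs => rw [hAB, Finset.filter_insert, ← hAB]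
        rw [f2, f3]
        have : (B.filter fun a => σ a ∧ c + (A.filter fun b => σ b ∧ κ b < κ a).card +
          (A.filter fun b => ¬ σ b ∧ κ a < κ b).card = j) =
          (B.filter fun a => σ a ∧ c + (B.filter fun b => σ b ∧ κ b < κ a).card +
          (B.filter fun b => ¬ σ b ∧ κ a < κ b).card = j) := by
          apply Finset.filter_congr
          intro a ha; rw [f1 a ha, f4 a ha]
        rw [this]
        by_cases hj : c + (B.filter fun b => σ b).card = j
        · rw [if_pos (by simpa [hs] using hj), if_pos hj, Finset.card_insert_of_notMem]
          intro h; exact htB (Finset.mem_of_mem_filter _ h)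
        · rw [if_neg (by simpa [hs] using hj), if_neg hj, add_zero]
      have g2 : (A.filter fun a => ¬ σ a ∧ c + (A.filter fun b => σ b ∧ κ b < κ a).card +
          (A.filter fun b => ¬ σ b ∧ κ a < κ b).card = j).card =
          (B.filter fun a => ¬ σ a ∧ c + (B.filter fun b => σ b ∧ κ b < κ a).card +
          (B.filter fun b => ¬ σ b ∧ κ a < κ b).card = j).card := by
        conv_lhs => rw [hAB, Finset.filter_insert, ← hAB]
        rw [if_neg (by simp [hs])]
        congr 1
        apply Finset.filter_congr
        intro a ha; rw [f1 a ha, f4 a ha]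
      have g3 : (A.filter fun a => σ a).card = (B.filter fun a => σ a).card + 1 := by
        rw [hAB, Finset.filter_insert, if_pos hs, Finset.card_insert_of_notMem]
        intro h; exact htB (Finset.mem_of_mem_filter _ h)
      have g4 : (A.filter fun a => ¬ σ a) = (B.filter fun a => ¬ σ a) := by
        rw [hAB, Finset.filter_insert, if_neg (by simp [hs])]
      rw [g1, g2, g3, g4]
      push_cast
      have : (if j < c + ((B.filter fun a => σ a).card + 1) then (1:ℤ) else 0) =
        (if j < c + (B.filter fun a => σ a).card then 1 else 0) +
        (if c + (B.filter fun b => σ b).card = j then 1 else 0) := by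
        split_ifs <;> omega
      linarith
    · have f4 : ∀ a ∈ B, (A.filter fun b => ¬ σ b ∧ κ a < κ b).card =
          (B.filter fun b => ¬ σ b ∧ κ a < κ b).card + 1 := by
        intro a ha
        rw [hAB, Finset.filter_insert, if_pos ⟨hs, hlt a ha⟩, Finset.card_insert_of_notMem]
        intro h; exact htB (Finset.mem_of_mem_filter _ h)
      have ihB := ih B (c + 1) hBc hBinj
      have g1 : (A.filter fun a => σ a ∧ c + (A.filter fun b => σ b ∧ κ b < κ a).card +
          (A.filter fun b => ¬ σ b ∧ κ a < κ b).card = j).card =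
          (B.filter fun a => σ a ∧ c + 1 + (B.filter fun b => σ b ∧ κ b < κ a).card +
          (B.filter fun b => ¬ σ b ∧ κ a < κ b).card = j).card := by
        conv_lhs => rw [hAB, Finset.filter_insert, ← hAB]
        rw [if_neg (by simp [hs])]
        congr 1
        apply Finset.filter_congr
        intro a ha; rw [f1 a ha, f4 a ha]
        constructor <;> rintro ⟨h1, h2⟩ <;> exact ⟨h1, by omega⟩
      have g2 : (A.filter fun a => ¬ σ a ∧ c + (A.filter fun b => σ b ∧ κ b < κ a).card +
          (A.filter fun b => ¬ σ b ∧ κ a < κ b).card = j).card =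
          (B.filter fun a => ¬ σ a ∧ c + 1 + (B.filter fun b => σ b ∧ κ b < κ a).card +
          (B.filter fun b => ¬ σ b ∧ κ a < κ b).card = j).card +
          (if c + (B.filter fun b => σ b).card = j then 1 else 0) := by
        conv_lhs => rw [hAB, Finset.filter_insert, ← hAB]
        rw [f2, f3]
        have : (B.filter fun a => ¬ σ a ∧ c + (A.filter fun b => σ b ∧ κ b < κ a).card +
          (A.filter fun b => ¬ σ b ∧ κ a < κ b).card = j) =
          (B.filter fun a => ¬ σ a ∧ c + 1 + (B.filter fun b => σ b ∧ κ b < κ a).card +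
          (B.filter fun b => ¬ σ b ∧ κ a < κ b).card = j) := by
          apply Finset.filter_congr
          intro a ha; rw [f1 a ha, f4 a ha]
          constructor <;> rintro ⟨h1, h2⟩ <;> exact ⟨h1, by omega⟩
        rw [this]
        by_cases hj : c + (B.filter fun b => σ b).card = j
        · rw [if_pos (by simpa [hs] using hj), if_pos hj, Finset.card_insert_of_notMem]
          intro h; exact htB (Finset.mem_of_mem_filter _ h)
        · rw [if_neg (by simpa [hs] using hj), if_neg hj, add_zero]
      have g3 : (A.filter fun a => σ a) = (B.filter fun a => σ a) := by
        rw [hAB, Finset.filter_insert, if_neg hs]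
      have g4 : (A.filter fun a => ¬ σ a).card = (B.filter fun a => ¬ σ a).card + 1 := by
        rw [hAB, Finset.filter_insert, if_pos hs, Finset.card_insert_of_notMem]
        intro h; exact htB (Finset.mem_of_mem_filter _ h)
      rw [g1, g2, g3, g4]
      push_cast
      have e1 : (if j < c + 1 + (B.filter fun a => σ a).card then (1:ℤ) else 0) =
        (if j < c + (B.filter fun a => σ a).card then 1 else 0) +
        (if c + (B.filter fun b => σ b).card = j then 1 else 0) := by
        split_ifs <;> omega
      have e2 : (if j < c + ((B.filter fun a => ¬ σ a).card + 1) then (1:ℤ) else 0) =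
        (if j < c + 1 + (B.filter fun a => ¬ σ a).card then 1 else 0) := by
        split_ifs <;> omega
      rw [e2]
      linarith

end PPk

namespace PPk

def sg (r : ℝ) : ℤ := if 0 < r then 1 else if r < 0 then -1 else 0

theorem sg_pos {r : ℝ} (h : 0 < r) : sg r = 1 := by simp [sg, h]
theorem sg_neg {r : ℝ} (h : r < 0) : sg r = -1 := by
  simp [sg, h, not_lt.2 h.le]
theorem sg_zero : sg 0 = 0 := by simp [sg]

/-- the right half-line walk -/
theorem half_walk {α : Type} (A : Finset α) (G : α → ℝ → ℝ) (t : α → ℝ)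
    (hinj : Set.InjOn t A)
    (hG : ∀ a ∈ A, (∀ x, (G a x < 0 ↔ x < t a) ∧ (0 < G a x ↔ t a < x)) ∨
      (∀ x, (G a x < 0 ↔ t a < x) ∧ (0 < G a x ↔ x < t a)))
    (x0 : ℝ) (j : ℕ) :
    ∑ a ∈ A.filter (fun a => x0 < t a),
      sg (G a x0) * (if (A.filter fun b => G b (t a) < 0).card = j then 1 else 0) ≤
    if (A.filter fun b => G b x0 < 0).card ≤ j then 1 else 0 := by
  set B := A.filter (fun a => x0 < t a) with hB
  set σ : α → Prop := fun a => ∀ x, (G a x < 0 ↔ t a < x) ∧ (0 < G a x ↔ x < t a) with hσ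
  have hσn : ∀ a ∈ A, ¬ σ a → ∀ x, (G a x < 0 ↔ x < t a) ∧ (0 < G a x ↔ t a < x) := by
    intro a ha h
    rcases hG a ha with h1 | h1
    · exact h1
    · exact absurd h1 h
  set c := (A.filter fun a => ¬ (x0 < t a) ∧ σ a).card with hc
  have hBA : B ⊆ A := Finset.filter_subset _ _
  have hw := walk t σ j B.card B c rfl (hinj.mono (by exact_mod_cast hBA))
  have hlev : ∀ a ∈ B, (A.filter fun b => G b (t a) < 0).card =
      c + (B.filter fun b => σ b ∧ t b < t a).card + (B.filter fun b => ¬ σ b ∧ t a < t b).card := by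
    intro a ha
    have hxa : x0 < t a := (Finset.mem_filter.1 ha).2
    rw [hc, ← Finset.card_union_of_disjoint, ← Finset.card_union_of_disjoint]
    · congr 1
      ext b
      simp only [hB, Finset.mem_union, Finset.mem_filter]
      by_cases hb : b ∈ A
      · by_cases hs : σ b
        · have := (hs (t a)).1
          simp only [hb, hs, true_and, not_true, and_true, false_and, and_false, or_false, this]
          by_cases h : x0 < t b
          · simp [h]
          · simp [h]; linarith
        · have := (hσn b hb hs (t a)).1
          simp only [hb, hs, true_and, not_true, and_true, false_and, and_false, or_false, this]
          simp
          intro h; linarith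
      · simp [hb]
    · rw [Finset.disjoint_left]
      intro b hb hb'
      simp only [hB, Finset.mem_union, Finset.mem_filter] at hb hb'
      tauto
    · rw [Finset.disjoint_left]
      intro b hb hb'
      simp only [hB, Finset.mem_filter] at hb hb'
      tauto
  have hsum : ∑ a ∈ B, sg (G a x0) * (if (A.filter fun b => G b (t a) < 0).card = j then 1 else 0)
      = ((B.filter fun a => σ a ∧ c + (B.filter fun b => σ b ∧ t b < t a).card +
        (B.filter fun b => ¬ σ b ∧ t a < t b).card = j).card : ℤ) -
    ((B.filter fun a => ¬ σ a ∧ c + (B.filter fun b => σ b ∧ t b < t a).card +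
        (B.filter fun b => ¬ σ b ∧ t a < t b).card = j).card : ℤ) := by
    rw [Finset.card_filter, Finset.card_filter]
    push_cast
    rw [← Finset.sum_sub_distrib]
    apply Finset.sum_congr rfl
    intro a ha
    rw [hlev a ha]
    have hxa : x0 < t a := (Finset.mem_filter.1 ha).2
    by_cases hs : σ a
    · rw [sg_pos ((hs x0).2.2 hxa)]
      simp [hs]
    · rw [sg_neg ((hσn a (hBA ha) hs x0).1.2 hxa)]
      by_cases hh : c + (B.filter fun b => σ b ∧ t b < t a).card +
        (B.filter fun b => ¬ σ b ∧ t a < t b).card = j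
      · simp [hs, hh]
      · simp [hh]
  rw [hsum, hw]
  have hle : (A.filter fun b => G b x0 < 0).card ≤ c + (B.filter fun a => ¬ σ a).card := by
    rw [hc]
    refine le_trans (Finset.card_le_card ?_) (Finset.card_union_le _ _)
    intro b hb
    simp only [hB, Finset.mem_union, Finset.mem_filter] at hb ⊢
    by_cases hs : σ b
    · have := (hs x0).1.1 hb.2
      left; exact ⟨hb.1, by linarith, hs⟩
    · have := (hσn b hb.1 hs x0).1.1 hb.2
      right; exact ⟨⟨hb.1, this⟩, hs⟩
  by_cases h1 : j < c + (B.filter fun a => ¬ σ a).card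
  · rw [if_pos h1]
    split_ifs <;> simp
  · rw [if_neg h1, if_pos (show (A.filter fun b => G b x0 < 0).card ≤ j by omega)]
    split_ifs <;> simp

theorem half_walk_left {α : Type} (A : Finset α) (G : α → ℝ → ℝ) (t : α → ℝ)
    (hinj : Set.InjOn t A)
    (hG : ∀ a ∈ A, (∀ x, (G a x < 0 ↔ x < t a) ∧ (0 < G a x ↔ t a < x)) ∨
      (∀ x, (G a x < 0 ↔ t a < x) ∧ (0 < G a x ↔ x < t a)))
    (x0 : ℝ) (j : ℕ) :
    ∑ a ∈ A.filter (fun a => t a < x0),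
      sg (G a x0) * (if (A.filter fun b => G b (t a) < 0).card = j then 1 else 0) ≤
    if (A.filter fun b => G b x0 < 0).card ≤ j then 1 else 0 := by
  have := half_walk A (fun a x => G a (-x)) (fun a => - t a)
    (fun a ha b hb h => hinj ha hb (neg_injective h))
    (by
      intro a ha
      rcases hG a ha with h | h
      · right
        intro x
        have := h (-x)
        refine ⟨this.1.trans neg_lt, this.2.trans lt_neg⟩
      · left
        intro x
        have := h (-x)
        refine ⟨this.1.trans lt_neg, this.2.trans neg_lt⟩) (-x0) j
  simpa using this

/-- swap cancellation -/
theorem sum_antisymm {α : Type} [Fintype α] (h : α → α → ℤ) (hh : ∀ a d, h a d = - h d a) :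
    ∑ a, ∑ d, h a d = 0 := by
  have h1 : ∑ a, ∑ d, h a d = ∑ a, ∑ d, h d a := Finset.sum_comm
  have h2 : ∑ a, ∑ d, h a d = - ∑ a, ∑ d, h d a := by
    rw [← Finset.sum_neg_distrib]
    apply Finset.sum_congr rfl
    intro a _
    rw [← Finset.sum_neg_distrib]
    apply Finset.sum_congr rfl
    intro d _
    exact hh a d
  linarith

namespace Fam
variable {α : Type} (F : Fam α)

/-- height of `a` above the curve of `b ∩ c` -/
def W (b c a : α) (x : ℝ) : ℝ := F.s a x (F.phi b c x)

def IsU (b c a : α) : Prop := a ≠ b ∧ a ≠ c ∧ F.Up b c a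
def IsD (b c a : α) : Prop := a ≠ b ∧ a ≠ c ∧ F.Dn b c a

theorem U_ne_D {b c d e : α} (hd : F.IsU b c d) (he : F.IsD b c e) : d ≠ e := by
  rintro rfl
  exact F.up_dn_false hd.2.2 he.2.2

/-- crossing of the two curves -/
def xv (b c d e : α) : ℝ := if h : ∃ x, F.phi b c x = F.phi d e x then h.choose else 0

theorem xv_iff {b c d e : α} (hbc : b ≠ c) (hd : F.IsU b c d) (he : F.IsD b c e) (x : ℝ) :
    F.W b c d x = F.W b c e x ↔ x = F.xv b c d e := by
  have hde := F.U_ne_D hd he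
  have hc := F.cross b c d e hbc hde hd.1.symm he.1.symm hd.2.1.symm he.2.1.symm
  have hs : F.phi b c (F.xv b c d e) = F.phi d e (F.xv b c d e) := by
    unfold xv
    rw [dif_pos hc.exists]
    exact hc.exists.choose_spec
  unfold W
  rw [F.phi_iff d e hde]
  constructor
  · intro h; exact hc.unique h hs
  · rintro rfl; exact hs

theorem xv_lt {b c d e : α} (hbc : b ≠ c) (hd : F.IsU b c d) (he : F.IsD b c e) (x : ℝ) :
    (F.W b c d x < F.W b c e x ↔ x < F.xv b c d e) ∧
    (F.W b c e x < F.W b c d x ↔ F.xv b c d e < x) := by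
  set v := F.xv b c d e with hv
  have hlow : ∀ x, x < F.T b c d → x < F.T b c e → F.W b c d x < F.W b c e x := by
    intro x h1 h2
    exact (hd.2.2.1 x h1).trans (he.2.2.1 x h2)
  have hhigh : ∀ x, F.T b c d < x → F.T b c e < x → F.W b c e x < F.W b c d x := by
    intro x h1 h2
    exact (he.2.2.2 x h2).trans (hd.2.2.2 x h1)
  set m := min v (min (F.T b c d) (F.T b c e)) with hm
  set M := max v (max (F.T b c d) (F.T b c e)) with hM
  have m1 : m ≤ v := min_le_left _ _
  have m2 : m ≤ F.T b c d := (min_le_right _ _).trans (min_le_left _ _)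
  have m3 : m ≤ F.T b c e := (min_le_right _ _).trans (min_le_right _ _)
  have M2 : F.T b c d ≤ M := (le_max_left _ _).trans (le_max_right _ _)
  have M3 : F.T b c e ≤ M := (le_max_right _ _).trans (le_max_right _ _)
  have l1 := hlow (m - 1) (by linarith) (by linarith)
  have l2 := hhigh (M + 1) (by linarith) (by linarith)
  have hs := sign_change (fun x => F.W b c d x - F.W b c e x)
    ((F.W_cont hbc d).sub (F.W_cont hbc e)) v
    (fun x hx => (F.xv_iff hbc hd he x).1 (by linarith))
    ⟨m - 1, by linarith⟩ ⟨M + 1, by linarith⟩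
  have hs' : (∀ x < v, F.W b c d x - F.W b c e x < 0) ∧ (∀ x > v, 0 < F.W b c d x - F.W b c e x) := by
    rcases hs with h | h
    · exact h
    · have := h.1 (m - 1) (by linarith)
      linarith
  have h0 := (F.xv_iff hbc hd he x).2
  rcases lt_trichotomy x v with h | h | h
  · have := hs'.1 x h
    exact ⟨⟨fun _ => h, fun _ => by linarith⟩, ⟨fun _ => by linarith, fun _ => by linarith⟩⟩
  · have := h0 h
    exact ⟨⟨fun _ => by linarith, fun _ => by linarith⟩, ⟨fun _ => by linarith, fun _ => by linarith⟩⟩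
  · have := hs'.2 x h
    exact ⟨⟨fun _ => by linarith, fun _ => by linarith⟩, ⟨fun _ => by linarith, fun _ => by linarith⟩⟩

theorem W_T {b c a : α} (hbc : b ≠ c) (hab : a ≠ b) (hac : a ≠ c) :
    F.W b c a (F.T b c a) = F.s b (F.T b c a) (F.phi b c (F.T b c a)) :=
  (F.s_T hbc hab.symm hac.symm).symm

/-- position of the crossing of a `DU` pair -/
theorem pair_pos {b c d e : α} (hbc : b ≠ c) (hd : F.IsU b c d) (he : F.IsD b c e)
    (hlt : F.T b c e < F.T b c d) : F.T b c e < F.xv b c d e ∧ F.xv b c d e < F.T b c d := by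
  constructor
  · rw [← (F.xv_lt hbc hd he _).1, F.W_T hbc he.1 he.2.1]
    exact hd.2.2.1 _ hlt
  · rw [← (F.xv_lt hbc hd he _).2, F.W_T hbc hd.1 hd.2.1]
    exact he.2.2.2 _ hlt

def IsPair (b c d e : α) : Prop := F.IsU b c d ∧ F.IsD b c e ∧ F.T b c e < F.T b c d

/-- alternating ordered triple -/
def AltT (b c a d e : α) : Prop := F.IsPair b c d e ∧
  ((F.IsU b c a ∧ F.T b c a < F.T b c e) ∨ (F.IsD b c a ∧ F.T b c d < F.T b c a))

def Alt (b c : α) (S : Finset α) : Prop := ∃ a d e, F.AltT b c a d e ∧ S = {a, d, e}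

theorem alt_above {b c a d e : α} (hbc : b ≠ c) (h : F.AltT b c a d e) :
    F.W b c d (F.xv b c d e) < F.W b c a (F.xv b c d e) := by
  obtain ⟨⟨hd, he, hlt⟩, h⟩ := h
  have hp := F.pair_pos hbc hd he hlt
  have h1 : F.W b c d (F.xv b c d e) < F.s b (F.xv b c d e) (F.phi b c (F.xv b c d e)) :=
    hd.2.2.1 _ hp.2
  refine h1.trans ?_
  rcases h with ⟨ha, h⟩ | ⟨ha, h⟩
  · exact ha.2.2.2 _ (by linarith)
  · exact ha.2.2.1 _ (by linarith)

theorem alt_ne {b c a d e : α} (h : F.AltT b c a d e) : a ≠ d ∧ a ≠ e ∧ d ≠ e := by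
  obtain ⟨⟨hd, he, hlt⟩, h⟩ := h
  refine ⟨?_, ?_, F.U_ne_D hd he⟩
  · rintro rfl
    rcases h with ⟨ha, h⟩ | ⟨ha, h⟩ <;> linarith
  · rintro rfl
    rcases h with ⟨ha, h⟩ | ⟨ha, h⟩ <;> linarith

end Fam
end PPk

namespace PPk
namespace Fam
variable {α : Type} (F : Fam α)

def Side (ε : Bool) (b c : α) (x y : ℝ) : Prop :=
  if ε then F.phi b c x < y else y < F.phi b c x

def lev2 [Fintype α] (b c : α) (x y z : ℝ) : ℕ :=
  (Finset.univ.filter fun a => a ≠ b ∧ a ≠ c ∧ F.s a x y < z).card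

def P3 [Fintype α] (b c : α) (ε : Bool) (j : ℕ) (S : Finset α) : Prop :=
  ∃ x y z, (∀ a ∈ S, F.s a x y = z) ∧ F.Side ε b c x y ∧ F.lev2 b c x y z = j

theorem P3_iff [Fintype α] (b c : α) (ε : Bool) (j : ℕ) {a d e : α} (hde : d ≠ e) (hda : d ≠ a)
    (hea : e ≠ a) :
    F.P3 b c ε j {a, d, e} ↔ F.Side ε b c (F.T d e a) (F.phi d e (F.T d e a)) ∧
      F.lev2 b c (F.T d e a) (F.phi d e (F.T d e a)) (F.s d (F.T d e a) (F.phi d e (F.T d e a))) = j := by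
  constructor
  · rintro ⟨x, y, z, hz, hs, hl⟩
    have h1 := hz a (by simp)
    have h2 := hz d (by simp)
    have h3 := hz e (by simp)
    have hy := (F.phi_iff d e hde x y).1 (h2.trans h3.symm)
    subst hy
    have hx : x = F.T d e a := F.T_unique hde hda hea (h2.trans h1.symm)
    subst hx
    rw [h2]
    exact ⟨hs, hl⟩
  · rintro ⟨hs, hl⟩
    refine ⟨_, _, _, ?_, hs, hl⟩
    intro u hu
    simp only [Finset.mem_insert, Finset.mem_singleton] at hu
    rcases hu with rfl | rfl | rfl
    · exact (F.s_T hde hda hea).symm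
    · rfl
    · exact (F.s_phi hde _).symm

theorem G_sign {d e a : α} (hde : d ≠ e) (hda : d ≠ a) (hea : e ≠ a) :
    (∀ x, (F.s a x (F.phi d e x) - F.s d x (F.phi d e x) < 0 ↔ x < F.T d e a) ∧
      (0 < F.s a x (F.phi d e x) - F.s d x (F.phi d e x) ↔ F.T d e a < x)) ∨
    (∀ x, (F.s a x (F.phi d e x) - F.s d x (F.phi d e x) < 0 ↔ F.T d e a < x) ∧
      (0 < F.s a x (F.phi d e x) - F.s d x (F.phi d e x) ↔ x < F.T d e a)) := by
  rcases F.up_or_dn hde hda hea with h | h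
  · left
    intro x
    rw [sub_neg, sub_pos]
    exact ⟨F.up_lt_iff hde hda hea h x, F.up_gt_iff hde hda hea h x⟩
  · right
    intro x
    rw [sub_neg, sub_pos]
    exact ⟨F.dn_lt_iff hde hda hea h x, F.dn_gt_iff hde hda hea h x⟩

theorem T_inj {d e a a' : α} (hde : d ≠ e) (hda : d ≠ a) (hea : e ≠ a) (hda' : d ≠ a') (hea' : e ≠ a')
    (h : F.T d e a = F.T d e a') : a = a' := by
  by_contra hne
  have h1 := F.s_T hde hda hea
  have h2 := F.s_T hde hda' hea'
  rw [← h] at h2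
  exact F.four d e a a' hde hda hda' hea hea' hne _ _ (F.s_phi hde _) h1 h2

/-- the curve of a pair lies on each side of `φ` as a half-line -/
theorem side_half {b c d e : α} (hbc : b ≠ c) (hd : F.IsU b c d) (he : F.IsD b c e) (ε : Bool) :
    (∀ x, F.Side ε b c x (F.phi d e x) ↔ F.xv b c d e < x) ∨
    (∀ x, F.Side ε b c x (F.phi d e x) ↔ x < F.xv b c d e) := by
  have hde := F.U_ne_D hd he
  have key : (∀ x, (F.phi b c x < F.phi d e x ↔ F.xv b c d e < x) ∧
      (F.phi d e x < F.phi b c x ↔ x < F.xv b c d e)) ∨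
      (∀ x, (F.phi b c x < F.phi d e x ↔ x < F.xv b c d e) ∧
      (F.phi d e x < F.phi b c x ↔ F.xv b c d e < x)) := by
    rcases F.prec_total hde with h | h
    · left
      intro x
      rw [← h.gt_iff, ← h.lt_iff]
      exact ⟨(F.xv_lt hbc hd he x).2, (F.xv_lt hbc hd he x).1⟩
    · right
      intro x
      rw [F.phi_comm hde, ← h.gt_iff, ← h.lt_iff]
      exact ⟨(F.xv_lt hbc hd he x).1, (F.xv_lt hbc hd he x).2⟩
  unfold Side
  cases ε
  · rcases key with h | h
    · right; intro x; simpa using (h x).2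
    · left; intro x; simpa using (h x).2
  · rcases key with h | h
    · left; intro x; simpa using (h x).1
    · right; intro x; simpa using (h x).1

theorem phi_xv {b c d e : α} (hbc : b ≠ c) (hd : F.IsU b c d) (he : F.IsD b c e) :
    F.phi d e (F.xv b c d e) = F.phi b c (F.xv b c d e) := by
  have := (F.xv_iff hbc hd he (F.xv b c d e)).2 rfl
  exact ((F.phi_iff d e (F.U_ne_D hd he) _ _).1 this).symm

theorem inner_sum [Fintype α] {b c d e : α} (hbc : b ≠ c) (hd : F.IsU b c d) (he : F.IsD b c e)
    (ε : Bool) (j : ℕ) :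
    ∑ a ∈ Finset.univ.filter (fun a => a ≠ b ∧ a ≠ c ∧ a ≠ d ∧ a ≠ e),
      sg (F.W b c a (F.xv b c d e) - F.W b c d (F.xv b c d e)) *
        (if F.P3 b c ε j {a, d, e} then 1 else 0) ≤
    if F.lev2 b c (F.xv b c d e) (F.phi b c (F.xv b c d e)) (F.W b c d (F.xv b c d e)) ≤ j
      then 1 else 0 := by
  have hde := F.U_ne_D hd he
  set A := Finset.univ.filter (fun a => a ≠ b ∧ a ≠ c ∧ a ≠ d ∧ a ≠ e) with hA
  set G : α → ℝ → ℝ := fun a x => F.s a x (F.phi d e x) - F.s d x (F.phi d e x) with hGdef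
  set v := F.xv b c d e with hv
  have hmem : ∀ a ∈ A, a ≠ b ∧ a ≠ c ∧ a ≠ d ∧ a ≠ e := by
    intro a ha; simpa [hA] using ha
  have hG : ∀ a ∈ A, (∀ x, (G a x < 0 ↔ x < F.T d e a) ∧ (0 < G a x ↔ F.T d e a < x)) ∨
      (∀ x, (G a x < 0 ↔ F.T d e a < x) ∧ (0 < G a x ↔ x < F.T d e a)) := by
    intro a ha
    obtain ⟨h1, h2, h3, h4⟩ := hmem a ha
    exact F.G_sign hde h3.symm h4.symm
  have hinj : Set.InjOn (fun a => F.T d e a) A := by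
    intro a ha a' ha' h
    obtain ⟨h1, h2, h3, h4⟩ := hmem a ha
    obtain ⟨h1', h2', h3', h4'⟩ := hmem a' ha'
    exact F.T_inj hde h3.symm h4.symm h3'.symm h4'.symm h
  have hlev : ∀ x, F.lev2 b c x (F.phi d e x) (F.s d x (F.phi d e x)) =
      (A.filter fun a' => G a' x < 0).card := by
    intro x
    unfold lev2
    congr 1
    ext a'
    simp only [hA, hGdef, Finset.mem_filter, Finset.mem_univ, true_and, sub_neg]
    constructor
    · rintro ⟨h1, h2, h3⟩
      refine ⟨⟨h1, h2, ?_, ?_⟩, h3⟩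
      · rintro rfl; exact lt_irrefl _ h3
      · rintro rfl; rw [F.s_phi hde] at h3; exact lt_irrefl _ h3
    · tauto
  have hpv : F.phi d e v = F.phi b c v := F.phi_xv hbc hd he
  have hlevv : F.lev2 b c v (F.phi b c v) (F.W b c d v) = (A.filter fun a' => G a' v < 0).card := by
    rw [← hlev v, hpv]; rfl
  have hGv : ∀ a, F.W b c a v - F.W b c d v = G a v := by
    intro a; simp only [hGdef, hpv]; rfl
  rw [hlevv]
  have hterm : ∀ a ∈ A, sg (F.W b c a v - F.W b c d v) *
        (if F.P3 b c ε j {a, d, e} then (1:ℤ) else 0) =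
      if F.Side ε b c (F.T d e a) (F.phi d e (F.T d e a)) then
        sg (G a v) * (if (A.filter fun a' => G a' (F.T d e a) < 0).card = j then 1 else 0) else 0 := by
    intro a ha
    obtain ⟨h1, h2, h3, h4⟩ := hmem a ha
    rw [hGv]
    have := F.P3_iff b c ε j hde h3.symm h4.symm
    rw [hlev] at this
    by_cases h : F.Side ε b c (F.T d e a) (F.phi d e (F.T d e a))
    · simp [this, h]
    · simp [this, h]
  rw [Finset.sum_congr rfl hterm, ← Finset.sum_filter]
  rcases F.side_half hbc hd he ε with hs | hs
  · have e1 : A.filter (fun a => F.Side ε b c (F.T d e a) (F.phi d e (F.T d e a))) =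
        A.filter (fun a => v < F.T d e a) := Finset.filter_congr (fun a _ => hs _)
    rw [e1]
    exact half_walk A G (fun a => F.T d e a) hinj hG v j
  · have e1 : A.filter (fun a => F.Side ε b c (F.T d e a) (F.phi d e (F.T d e a))) =
        A.filter (fun a => F.T d e a < v) := Finset.filter_congr (fun a _ => hs _)
    rw [e1]
    exact half_walk_left A G (fun a => F.T d e a) hinj hG v j

/-- antisymmetry in `U` -/
theorem sg_U {b c a d e : α} (hbc : b ≠ c) (ha : F.IsU b c a) (hd : F.IsU b c d) (he : F.IsD b c e) :
    sg (F.W b c a (F.xv b c d e) - F.W b c d (F.xv b c d e)) =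
      sg (F.xv b c d e - F.xv b c a e) := by
  have h1 := F.xv_lt hbc ha he (F.xv b c d e)
  have h2 := (F.xv_iff hbc hd he (F.xv b c d e)).2 rfl
  rw [h2]
  rcases lt_trichotomy (F.xv b c d e) (F.xv b c a e) with h | h | h
  · rw [sg_neg (by linarith [h1.1.2 h]), sg_neg (by linarith)]
  · have := (F.xv_iff hbc ha he (F.xv b c d e)).2 h
    rw [this, h]; simp
  · rw [sg_pos (by linarith [h1.2.2 h]), sg_pos (by linarith)]

theorem sg_D {b c a d e : α} (hbc : b ≠ c) (ha : F.IsD b c a) (hd : F.IsU b c d) (he : F.IsD b c e) :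
    sg (F.W b c a (F.xv b c d e) - F.W b c d (F.xv b c d e)) =
      sg (F.xv b c d a - F.xv b c d e) := by
  have h1 := F.xv_lt hbc hd ha (F.xv b c d e)
  rcases lt_trichotomy (F.xv b c d e) (F.xv b c d a) with h | h | h
  · rw [sg_pos (by linarith [h1.1.2 h]), sg_pos (by linarith)]
  · have := (F.xv_iff hbc hd ha (F.xv b c d e)).2 h
    rw [this, h]; simp
  · rw [sg_neg (by linarith [h1.2.2 h]), sg_neg (by linarith)]

theorem sg_swap (x y : ℝ) : sg (x - y) = - sg (y - x) := by
  rcases lt_trichotomy x y with h | h | h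
  · rw [sg_neg (by linarith), sg_pos (by linarith)]
  · subst h; simp [sg_zero]
  · rw [sg_pos (by linarith), sg_neg (by linarith)]; simp

/-- main counting inequality -/
theorem alt_count [Fintype α] {b c : α} (hbc : b ≠ c) (ε : Bool) (j : ℕ) :
    (Finset.univ.filter fun q : α × α × α =>
      F.AltT b c q.1 q.2.1 q.2.2 ∧ F.P3 b c ε j {q.1, q.2.1, q.2.2}).card ≤
    (Finset.univ.filter fun q : α × α => F.IsPair b c q.1 q.2 ∧
      F.lev2 b c (F.xv b c q.1 q.2) (F.phi b c (F.xv b c q.1 q.2))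
        (F.W b c q.1 (F.xv b c q.1 q.2)) ≤ j).card := by
  set g : α → α → α → ℤ := fun a d e => if F.P3 b c ε j {a, d, e} then 1 else 0 with hg
  have hg1 : ∀ a d e, g a d e = g d a e := by
    intro a d e; simp only [hg]; rw [Finset.insert_comm]
  have hg2 : ∀ a d e, g a d e = g e d a := by
    intro a d e; simp only [hg]
    have : ({a, d, e} : Finset α) = {e, d, a} := by
      ext u; simp; tauto
    rw [this]
  set σ : α → α → α → ℤ := fun a d e =>
    sg (F.W b c a (F.xv b c d e) - F.W b c d (F.xv b c d e)) with hσ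
  set f : α → α → α → ℤ := fun a d e =>
    if F.IsPair b c d e ∧ a ≠ b ∧ a ≠ c ∧ a ≠ d ∧ a ≠ e then σ a d e * g a d e else 0 with hf
  set hU : α → α → α → ℤ := fun e a d =>
    if F.IsU b c a ∧ F.IsU b c d ∧ F.IsD b c e ∧ F.T b c e < F.T b c d ∧ F.T b c e < F.T b c a
    then sg (F.xv b c d e - F.xv b c a e) * g a d e else 0 with hhU
  set hD : α → α → α → ℤ := fun d a e =>
    if F.IsD b c a ∧ F.IsU b c d ∧ F.IsD b c e ∧ F.T b c e < F.T b c d ∧ F.T b c a < F.T b c d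
    then sg (F.xv b c d a - F.xv b c d e) * g a d e else 0 with hhD
  set al : α → α → α → ℤ := fun a d e =>
    if F.AltT b c a d e ∧ F.P3 b c ε j {a, d, e} then 1 else 0 with hal
  have hdec : ∀ a d e, f a d e = hU e a d + hD d a e + al a d e := by
    intro a d e
    by_cases hp : F.IsPair b c d e
    · obtain ⟨hd, he, hlt⟩ := hp
      have hp : F.IsPair b c d e := ⟨hd, he, hlt⟩
      by_cases hb : a = b
      · have n1 : ¬ F.IsU b c a := fun h => h.1 hb
        have n2 : ¬ F.IsD b c a := fun h => h.1 hb
        have n3 : ¬ F.AltT b c a d e := by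
          rintro ⟨-, ⟨h', -⟩ | ⟨h', -⟩⟩
          · exact n1 h'
          · exact n2 h'
        have e1 : hU e a d = 0 := if_neg (fun h => n1 h.1)
        have e2 : hD d a e = 0 := if_neg (fun h => n2 h.1)
        have e3 : al a d e = 0 := if_neg (fun h => n3 h.1)
        have e4 : f a d e = 0 := if_neg (fun h => h.2.1 hb)
        rw [e1, e2, e3, e4]; simp
      by_cases hc : a = c
      · have n1 : ¬ F.IsU b c a := fun h => h.2.1 hc
        have n2 : ¬ F.IsD b c a := fun h => h.2.1 hc
        have n3 : ¬ F.AltT b c a d e := by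
          rintro ⟨-, ⟨h', -⟩ | ⟨h', -⟩⟩
          · exact n1 h'
          · exact n2 h'
        have e1 : hU e a d = 0 := if_neg (fun h => n1 h.1)
        have e2 : hD d a e = 0 := if_neg (fun h => n2 h.1)
        have e3 : al a d e = 0 := if_neg (fun h => n3 h.1)
        have e4 : f a d e = 0 := if_neg (fun h => h.2.2.1 hc)
        rw [e1, e2, e3, e4]; simp
      rcases F.up_or_dn hbc (Ne.symm hb) (Ne.symm hc) with hu | hu
      · have ha : F.IsU b c a := ⟨hb, hc, hu⟩
        have na : ¬ F.IsD b c a := fun h => F.up_dn_false hu h.2.2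
        have hae := F.U_ne_D ha he
        have e2 : hD d a e = 0 := by simp [hhD, na]
        rw [e2, add_zero]
        by_cases had : a = d
        · subst had
          have : ¬ F.AltT b c a a e := fun h => (F.alt_ne h).1 rfl
          simp [hf, hhU, hal, this, sg_zero]
        have ef : f a d e = σ a d e * g a d e := by simp [hf, hp, hb, hc, had, hae]
        have es := F.sg_U hbc ha hd he
        rcases lt_trichotomy (F.T b c a) (F.T b c e) with h | h | h
        · have hA : F.AltT b c a d e := ⟨hp, Or.inl ⟨ha, h⟩⟩
          have e1 : hU e a d = 0 := by
            simp only [hhU]; rw [if_neg]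
            rintro ⟨-, -, -, -, h'⟩; linarith
          have e3 : σ a d e = 1 := sg_pos (by linarith [F.alt_above hbc hA])
          rw [ef, e1, e3]; simp [hal, hg, hA]
        · exact absurd (F.T_inj hbc ha.1.symm ha.2.1.symm he.1.symm he.2.1.symm h) hae
        · have hA : ¬ F.AltT b c a d e := by
            rintro ⟨-, ⟨-, h'⟩ | ⟨h', -⟩⟩
            · linarith
            · exact na h'
          have e1 : hU e a d = σ a d e * g a d e := by
            simp only [hhU]; rw [if_pos ⟨ha, hd, he, hlt, h⟩, hσ, ← es]
          rw [ef, e1]; simp [hal, hA]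
      · have ha : F.IsD b c a := ⟨hb, hc, hu⟩
        have na : ¬ F.IsU b c a := fun h => F.up_dn_false h.2.2 hu
        have had := (F.U_ne_D hd ha).symm
        have e2 : hU e a d = 0 := by simp [hhU, na]
        rw [e2, zero_add]
        by_cases hae : a = e
        · subst hae
          have : ¬ F.AltT b c a d a := fun h => (F.alt_ne h).2.1 rfl
          simp [hf, hhD, hal, this, sg_zero]
        have ef : f a d e = σ a d e * g a d e := by simp [hf, hp, hb, hc, had, hae]
        have es := F.sg_D hbc ha hd he
        rcases lt_trichotomy (F.T b c d) (F.T b c a) with h | h | h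
        · have hA : F.AltT b c a d e := ⟨hp, Or.inr ⟨ha, h⟩⟩
          have e1 : hD d a e = 0 := by
            simp only [hhD]; rw [if_neg]
            rintro ⟨-, -, -, -, h'⟩; linarith
          have e3 : σ a d e = 1 := sg_pos (by linarith [F.alt_above hbc hA])
          rw [ef, e1, e3]; simp [hal, hg, hA]
        · exact absurd (F.T_inj hbc hd.1.symm hd.2.1.symm ha.1.symm ha.2.1.symm h).symm had
        · have hA : ¬ F.AltT b c a d e := by
            rintro ⟨-, ⟨h', -⟩ | ⟨-, h'⟩⟩
            · exact na h'
            · linarith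
          have e1 : hD d a e = σ a d e * g a d e := by
            simp only [hhD]; rw [if_pos ⟨ha, hd, he, hlt, h⟩, hσ, ← es]
          rw [ef, e1]; simp [hal, hA]
    · have n1 : ¬ F.AltT b c a d e := fun h => hp h.1
      have e1 : hU e a d = 0 := by
        simp only [hhU]; rw [if_neg]
        rintro ⟨-, h1, h2, h3, -⟩; exact hp ⟨h1, h2, h3⟩
      have e2 : hD d a e = 0 := by
        simp only [hhD]; rw [if_neg]
        rintro ⟨-, h1, h2, h3, -⟩; exact hp ⟨h1, h2, h3⟩
      rw [e1, e2]
      simp [hf, hal, hp, n1]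
  have sU : ∀ e, ∑ a, ∑ d, hU e a d = 0 := by
    intro e
    apply sum_antisymm
    intro a d
    simp only [hhU]
    by_cases h : F.IsU b c a ∧ F.IsU b c d ∧ F.IsD b c e ∧ F.T b c e < F.T b c d ∧ F.T b c e < F.T b c a
    · rw [if_pos h, if_pos ⟨h.2.1, h.1, h.2.2.1, h.2.2.2.2, h.2.2.2.1⟩, hg1 a d e,
        sg_swap]
      ring
    · rw [if_neg h, if_neg]
      · simp
      · rintro ⟨h1, h2, h3, h4, h5⟩; exact h ⟨h2, h1, h3, h5, h4⟩
  have sD : ∀ d, ∑ a, ∑ e, hD d a e = 0 := by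
    intro d
    apply sum_antisymm
    intro a e
    simp only [hhD]
    by_cases h : F.IsD b c a ∧ F.IsU b c d ∧ F.IsD b c e ∧ F.T b c e < F.T b c d ∧ F.T b c a < F.T b c d
    · rw [if_pos h, if_pos ⟨h.2.2.1, h.2.1, h.1, h.2.2.2.2, h.2.2.2.1⟩, hg2 a d e,
        sg_swap]
      ring
    · rw [if_neg h, if_neg]
      · simp
      · rintro ⟨h1, h2, h3, h4, h5⟩; exact h ⟨h3, h2, h1, h5, h4⟩
  have tot : ∑ d, ∑ e, ∑ a, f a d e = ∑ d, ∑ e, ∑ a, al a d e := by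
    have : ∑ d, ∑ e, ∑ a, f a d e = ∑ d, ∑ e, ∑ a, hU e a d + ∑ d, ∑ e, ∑ a, hD d a e
        + ∑ d, ∑ e, ∑ a, al a d e := by
      simp only [hdec, Finset.sum_add_distrib]
    rw [this]
    have z1 : ∑ d, ∑ e, ∑ a, hU e a d = 0 := by
      rw [Finset.sum_comm]
      apply Finset.sum_eq_zero
      intro e _
      rw [Finset.sum_comm]; exact sU e
    have z2 : ∑ d, ∑ e, ∑ a, hD d a e = 0 := by
      apply Finset.sum_eq_zero
      intro d _
      rw [Finset.sum_comm]; exact sD d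
    rw [z1, z2]; ring
  have up : ∑ d, ∑ e, ∑ a, f a d e ≤ ∑ d, ∑ e, if F.IsPair b c d e ∧
      F.lev2 b c (F.xv b c d e) (F.phi b c (F.xv b c d e)) (F.W b c d (F.xv b c d e)) ≤ j
      then (1:ℤ) else 0 := by
    apply Finset.sum_le_sum; intro d _
    apply Finset.sum_le_sum; intro e _
    by_cases hp : F.IsPair b c d e
    · have := F.inner_sum hbc hp.1 hp.2.1 ε j
      rw [Finset.sum_filter] at this
      simp only [hf, hp, true_and]
      exact this
    · simp [hf, hp]
  have c1 : ((Finset.univ.filter fun q : α × α × α =>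
      F.AltT b c q.1 q.2.1 q.2.2 ∧ F.P3 b c ε j {q.1, q.2.1, q.2.2}).card : ℤ) =
      ∑ d, ∑ e, ∑ a, al a d e := by
    rw [Finset.card_filter]
    push_cast
    rw [Fintype.sum_prod_type]
    simp only [Fintype.sum_prod_type]
    rw [Finset.sum_comm]
    apply Finset.sum_congr rfl
    intro d _
    rw [Finset.sum_comm]
  have c2 : ((Finset.univ.filter fun q : α × α => F.IsPair b c q.1 q.2 ∧
      F.lev2 b c (F.xv b c q.1 q.2) (F.phi b c (F.xv b c q.1 q.2))
        (F.W b c q.1 (F.xv b c q.1 q.2)) ≤ j).card : ℤ) =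
      ∑ d, ∑ e, if F.IsPair b c d e ∧
      F.lev2 b c (F.xv b c d e) (F.phi b c (F.xv b c d e)) (F.W b c d (F.xv b c d e)) ≤ j
      then (1:ℤ) else 0 := by
    rw [Finset.card_filter]
    push_cast
    rw [Fintype.sum_prod_type]
  have : ((Finset.univ.filter fun q : α × α × α =>
      F.AltT b c q.1 q.2.1 q.2.2 ∧ F.P3 b c ε j {q.1, q.2.1, q.2.2}).card : ℤ) ≤
      ((Finset.univ.filter fun q : α × α => F.IsPair b c q.1 q.2 ∧
      F.lev2 b c (F.xv b c q.1 q.2) (F.phi b c (F.xv b c q.1 q.2))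
        (F.W b c q.1 (F.xv b c q.1 q.2)) ≤ j).card : ℤ) := by
    rw [c1, c2, ← tot]; exact up
  exact_mod_cast this

end Fam
end PPk

namespace PPk
namespace Fam
variable {α : Type} (F : Fam α)

theorem card_through_le (Z : Finset α) (x y z : ℝ) (hZ : ∀ a ∈ Z, F.s a x y = z) : Z.card ≤ 3 := by
  by_contra h
  push Not at h
  obtain ⟨Y, hY, hc⟩ := Finset.exists_subset_card_eq (show 4 ≤ Z.card by omega)
  obtain ⟨a, b, c, d, h1, h2, h3, h4, h5, h6, rfl⟩ := Finset.card_eq_four.1 hc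
  have ha := hZ a (hY (by simp))
  have hb := hZ b (hY (by simp))
  have hc := hZ c (hY (by simp))
  have hd := hZ d (hY (by simp))
  exact F.four a b c d h1 h2 h3 h4 h5 h6 x y (by linarith) (by linarith) (by linarith)

theorem pairs_bound [Fintype α] {b c : α} (hbc : b ≠ c) (k : ℕ) (hk : 1 ≤ k) :
    ((Finset.univ.filter fun q : α × α => F.IsPair b c q.1 q.2 ∧
      F.lev2 b c (F.xv b c q.1 q.2) (F.phi b c (F.xv b c q.1 q.2))
        (F.W b c q.1 (F.xv b c q.1 q.2)) ≤ k).card : ℝ) ≤ 72 * k ^ 2 := by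
  set τ := (Finset.univ.filter fun q : α × α => F.IsPair b c q.1 q.2 ∧
      F.lev2 b c (F.xv b c q.1 q.2) (F.phi b c (F.xv b c q.1 q.2))
        (F.W b c q.1 (F.xv b c q.1 q.2)) ≤ k) with hτ
  set K : α × α → Finset α := fun q => Finset.univ.filter fun a => a ≠ b ∧ a ≠ c ∧
    F.s a (F.xv b c q.1 q.2) (F.phi b c (F.xv b c q.1 q.2)) < F.W b c q.1 (F.xv b c q.1 q.2) with hK
  have hp : ∀ t ∈ τ, F.IsPair b c t.1 t.2 := fun t ht => (Finset.mem_filter.1 ht).2.1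
  have := clarkson_shor (Finset.univ : Finset α) τ (fun q => {q.1, q.2}) K (by simp) (by simp)
    (by
      intro t ht
      have h := hp t ht
      rw [Finset.disjoint_left]
      intro a ha ha'
      have h1 := (Finset.mem_filter.1 ha').2.2.2
      have h2 := (F.xv_iff hbc h.1 h.2.1 _).2 rfl
      simp only [Finset.mem_insert, Finset.mem_singleton] at ha
      rcases ha with rfl | rfl
      · exact lt_irrefl _ h1
      · rw [h2] at h1; exact lt_irrefl _ h1) k hk
    (by
      intro t ht
      exact Finset.card_pair (F.U_ne_D (hp t ht).1 (hp t ht).2.1))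
    (by
      intro t ht
      exact (Finset.mem_filter.1 ht).2.2) 0 9
    (by
      intro R _
      rw [zero_mul, zero_add]
      set τ' := τ.filter fun t => ({t.1, t.2} : Finset α) ⊆ R ∧ Disjoint (K t) R with hτ'
      rcases τ'.eq_empty_or_nonempty with h0 | ⟨⟨d, e⟩, h0⟩
      · rw [h0]; norm_num
      · have hnot : ∀ t ∈ τ', ∀ t' ∈ τ', ∀ u ∈ ({t'.1, t'.2} : Finset α),
            F.W b c t.1 (F.xv b c t.1 t.2) ≤ F.W b c u (F.xv b c t.1 t.2) := by
          intro t ht t' ht' u hu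
          by_contra hlt
          push Not at hlt
          have h1 := Finset.mem_filter.1 ht
          have h2 := Finset.mem_filter.1 ht'
          have h3 := hp t' h2.1
          have huR := h2.2.1 hu
          refine Finset.disjoint_left.1 h1.2.2 ?_ huR
          simp only [hK, Finset.mem_filter, Finset.mem_univ, true_and]
          simp only [Finset.mem_insert, Finset.mem_singleton] at hu
          rcases hu with rfl | rfl
          · exact ⟨h3.1.1, h3.1.2.1, hlt⟩
          · exact ⟨h3.2.1.1, h3.2.1.2.1, hlt⟩
        have hpp : ∀ t ∈ τ', F.IsPair b c t.1 t.2 := fun t ht => hp t (Finset.mem_filter.1 ht).1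
        set x0 := F.xv b c d e with hx0
        set Z := Finset.univ.filter fun a => F.s a x0 (F.phi b c x0) = F.W b c d x0 with hZ
        have hZc : Z.card ≤ 3 := F.card_through_le Z x0 (F.phi b c x0) (F.W b c d x0) (by
          intro a ha; exact (Finset.mem_filter.1 ha).2)
        have hsub : τ' ⊆ Z ×ˢ Z := by
          rintro ⟨d', e'⟩ ht'
          have p0 := hpp _ h0
          have p1 := hpp _ ht'
          simp only at p0 p1
          have a1 := hnot _ h0 _ ht' d' (by simp)
          have a2 := hnot _ h0 _ ht' e' (by simp)
          have a3 := hnot _ ht' _ h0 d (by simp)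
          have a4 := hnot _ ht' _ h0 e (by simp)
          simp only at a1 a2 a3 a4
          have q0 := (F.xv_iff hbc p0.1 p0.2.1 _).2 rfl
          have q1 := (F.xv_iff hbc p1.1 p1.2.1 _).2 rfl
          rw [q0] at a1
          rw [q1] at a3
          have b1 := mt (F.xv_lt hbc p1.1 p0.2.1 (F.xv b c d e)).1.2 (not_lt.2 a1)
          have b2 := mt (F.xv_lt hbc p0.1 p1.2.1 (F.xv b c d e)).2.2 (not_lt.2 a2)
          have b3 := mt (F.xv_lt hbc p0.1 p1.2.1 (F.xv b c d' e')).1.2 (not_lt.2 a3)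
          have b4 := mt (F.xv_lt hbc p1.1 p0.2.1 (F.xv b c d' e')).2.2 (not_lt.2 a4)
          have c1 : x0 = F.xv b c d' e := by linarith
          have c2 : x0 = F.xv b c d e' := by linarith
          have d1 := (F.xv_iff hbc p1.1 p0.2.1 x0).2 c1
          have d2 := (F.xv_iff hbc p0.1 p1.2.1 x0).2 c2
          rw [← hx0] at q0
          simp only [hZ, Finset.mem_product, Finset.mem_filter, Finset.mem_univ, true_and]
          exact ⟨d1.trans q0.symm, d2.symm⟩
        have h1 := Finset.card_le_card hsub
        rw [Finset.card_product] at h1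
        have h2 : τ'.card ≤ 9 := h1.trans (by nlinarith)
        exact_mod_cast h2)
  linarith

/-- vertex at level `k` -/
def Vk [Fintype α] (k : ℕ) (S : Finset α) : Prop :=
  ∃ x y z, (∀ a ∈ S, F.s a x y = z) ∧ (Finset.univ.filter fun a => F.s a x y < z).card = k

theorem lovasz [Fintype α] {b c : α} (hbc : b ≠ c) (k : ℕ) (hk : 1 ≤ k) :
    ((Finset.univ.filter fun S : Finset α => F.Alt b c S ∧ F.Vk k S).card : ℝ) ≤ 432 * k ^ 2 := by
  set N := (Finset.univ.filter fun q : α × α => F.IsPair b c q.1 q.2 ∧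
      F.lev2 b c (F.xv b c q.1 q.2) (F.phi b c (F.xv b c q.1 q.2))
        (F.W b c q.1 (F.xv b c q.1 q.2)) ≤ k).card with hN
  have hNb : (N : ℝ) ≤ 72 * k ^ 2 := F.pairs_bound hbc k hk
  set I := (Finset.univ : Finset Bool) ×ˢ Finset.Icc (k - 2) k with hI
  set Q : Bool × ℕ → Finset (Finset α) := fun i =>
    (Finset.univ.filter fun q : α × α × α =>
      F.AltT b c q.1 q.2.1 q.2.2 ∧ F.P3 b c i.1 i.2 {q.1, q.2.1, q.2.2}).image
      (fun q => {q.1, q.2.1, q.2.2}) with hQ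
  have hQc : ∀ i ∈ I, (Q i).card ≤ N := by
    intro i hi
    refine Finset.card_image_le.trans ((F.alt_count hbc i.1 i.2).trans ?_)
    apply Finset.card_le_card
    intro q hq
    simp only [Finset.mem_filter, Finset.mem_univ, true_and] at hq ⊢
    refine ⟨hq.1, hq.2.trans ?_⟩
    exact (Finset.mem_Icc.1 (Finset.mem_product.1 hi).2).2
  have hsub : (Finset.univ.filter fun S : Finset α => F.Alt b c S ∧ F.Vk k S) ⊆ I.biUnion Q := by
    intro S hS
    obtain ⟨⟨a, d, e, hA, rfl⟩, x, y, z, hz, hlev⟩ := (Finset.mem_filter.1 hS).2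
    obtain ⟨had, hae, hde⟩ := F.alt_ne hA
    obtain ⟨⟨hd, he, hlt⟩, hA'⟩ := hA
    have hA : F.AltT b c a d e := ⟨⟨hd, he, hlt⟩, hA'⟩
    have h1 := hz a (by simp)
    have h2 := hz d (by simp)
    have h3 := hz e (by simp)
    have hside : y ≠ F.phi b c x := by
      intro hy
      subst hy
      have hx := (F.xv_iff hbc hd he x).1 (h2.trans h3.symm)
      have := F.alt_above hbc hA
      rw [← hx] at this
      unfold W at this
      linarith
    have hl2 : k - 2 ≤ F.lev2 b c x y z ∧ F.lev2 b c x y z ≤ k := by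
      have e1 : F.lev2 b c x y z = (((Finset.univ.filter fun a => F.s a x y < z).erase b).erase c).card := by
        unfold lev2
        congr 1
        ext u
        simp only [Finset.mem_filter, Finset.mem_erase, Finset.mem_univ, true_and]
        tauto
      have e2 := Finset.pred_card_le_card_erase (s := (Finset.univ.filter fun a => F.s a x y < z)) (a := b)
      have e3 := Finset.pred_card_le_card_erase
        (s := ((Finset.univ.filter fun a => F.s a x y < z)).erase b) (a := c)
      have e4 := Finset.card_erase_le (s := (Finset.univ.filter fun a => F.s a x y < z)) (a := b)
      have e5 := Finset.card_erase_le
        (s := ((Finset.univ.filter fun a => F.s a x y < z)).erase b) (a := c)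
      rw [e1]
      omega
    rw [Finset.mem_biUnion]
    have : ∃ ε, F.Side ε b c x y := by
      rcases lt_or_gt_of_ne hside with h | h
      · exact ⟨false, by simpa [Side] using h⟩
      · exact ⟨true, by simpa [Side] using h⟩
    obtain ⟨ε, hε⟩ := this
    refine ⟨(ε, F.lev2 b c x y z), ?_, ?_⟩
    · rw [hI, Finset.mem_product]
      exact ⟨Finset.mem_univ _, Finset.mem_Icc.2 hl2⟩
    · rw [hQ, Finset.mem_image]
      refine ⟨(a, d, e), ?_, rfl⟩
      simp only [Finset.mem_filter, Finset.mem_univ, true_and]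
      exact ⟨hA, x, y, z, hz, hε, rfl⟩
  have h1 := (Finset.card_le_card hsub).trans (Finset.card_biUnion_le_card_mul I Q N hQc)
  have hIc : I.card ≤ 6 := by
    rw [hI, Finset.card_product, Nat.card_Icc]
    simp only [Finset.card_univ, Fintype.card_bool]
    omega
  have h2 : (Finset.univ.filter fun S : Finset α => F.Alt b c S ∧ F.Vk k S).card ≤ 6 * N :=
    h1.trans (Nat.mul_le_mul_right _ hIc)
  have h3 : ((Finset.univ.filter fun S : Finset α => F.Alt b c S ∧ F.Vk k S).card : ℝ) ≤ 6 * N := by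
    exact_mod_cast h2
  linarith

end Fam
end PPk

namespace PPk
namespace Fam
variable {α : Type} (F : Fam α)

def OnEnv (R S : Finset α) : Prop :=
  ∃ x y z, (∀ u ∈ S, F.s u x y = z) ∧ ∀ r ∈ R, z ≤ F.s r x y

theorem sort3 {b c r : α} (hbc : b ≠ c) (hbr : b ≠ r) (hcr : c ≠ r) :
    ∃ a' b' c', F.prec a' b' ∧ F.prec b' c' ∧ ({a', b', c'} : Finset α) = {b, c, r} := by
  rcases F.prec_total hbc with h1 | h1 <;> rcases F.prec_total hbr with h2 | h2 <;>
    rcases F.prec_total hcr with h3 | h3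
  · exact ⟨b, c, r, h1, h3, rfl⟩
  · exact ⟨b, r, c, h2, h3, by ext; simp; tauto⟩
  · exact (F.prec_asymm (F.prec_trans h1 h3) h2).elim
  · exact ⟨r, b, c, h2, h1, by ext; simp; tauto⟩
  · exact ⟨c, b, r, h1, h2, by ext; simp; tauto⟩
  · exact (F.prec_asymm (F.prec_trans h2 h3) h1).elim
  · exact ⟨c, r, b, h3, h2, by ext; simp; tauto⟩
  · exact ⟨r, c, b, h3, h1, by ext; simp; tauto⟩

theorem env_vertex {R : Finset α} {b c : α} (hbc : b ≠ c) {x : ℝ}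
    (hx : ∀ r ∈ R, F.s b x (F.phi b c x) ≤ F.s r x (F.phi b c x))
    (hne : ∃ r ∈ R, r ≠ b ∧ r ≠ c) :
    ∃ r ∈ R, r ≠ b ∧ r ≠ c ∧ F.OnEnv R {b, c, r} := by
  have hkey : ∀ r ∈ R, r ≠ b → r ≠ c →
      (∀ r' ∈ R, r' ≠ b → r' ≠ c → F.s b (F.T b c r) (F.phi b c (F.T b c r)) ≤
        F.s r' (F.T b c r) (F.phi b c (F.T b c r))) → F.OnEnv R {b, c, r} := by
    intro r hr hrb hrc h
    refine ⟨F.T b c r, F.phi b c (F.T b c r), F.s b (F.T b c r) (F.phi b c (F.T b c r)), ?_, ?_⟩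
    · intro u hu
      simp only [Finset.mem_insert, Finset.mem_singleton] at hu
      rcases hu with rfl | rfl | rfl
      · rfl
      · exact (F.s_phi hbc _).symm
      · exact (F.s_T hbc hrb.symm hrc.symm).symm
    · intro r' hr'
      by_cases h1 : r' = b
      · rw [h1]
      by_cases h2 : r' = c
      · rw [h2]; exact (F.s_phi hbc _).le
      exact h r' hr' h1 h2
  set RU := R.filter (fun r => F.IsU b c r) with hRU
  set RD := R.filter (fun r => F.IsD b c r) with hRD
  have hU : ∀ r ∈ RU, F.T b c r ≤ x := by
    intro r hr
    obtain ⟨h1, h2, h3, h4⟩ := Finset.mem_filter.1 hr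
    by_contra h
    push Not at h
    have := h4.1 x h
    linarith [hx r h1]
  have hD : ∀ r ∈ RD, x ≤ F.T b c r := by
    intro r hr
    obtain ⟨h1, h2, h3, h4⟩ := Finset.mem_filter.1 hr
    by_contra h
    push Not at h
    have := h4.2 x h
    linarith [hx r h1]
  have hcase : ∀ r ∈ R, r ≠ b → r ≠ c → r ∈ RU ∨ r ∈ RD := by
    intro r hr h1 h2
    rcases F.up_or_dn hbc h1.symm h2.symm with h | h
    · left; exact Finset.mem_filter.2 ⟨hr, h1, h2, h⟩
    · right; exact Finset.mem_filter.2 ⟨hr, h1, h2, h⟩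
  have lowU : ∀ r' ∈ RU, ∀ t, F.T b c r' ≤ t → F.s b t (F.phi b c t) ≤ F.s r' t (F.phi b c t) := by
    intro r hr t ht
    obtain ⟨h1, h2, h3, h4⟩ := Finset.mem_filter.1 hr
    by_contra h
    push Not at h
    rw [F.up_lt_iff hbc h2.symm h3.symm h4] at h
    linarith
  have lowD : ∀ r' ∈ RD, ∀ t, t ≤ F.T b c r' → F.s b t (F.phi b c t) ≤ F.s r' t (F.phi b c t) := by
    intro r hr t ht
    obtain ⟨h1, h2, h3, h4⟩ := Finset.mem_filter.1 hr
    by_contra h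
    push Not at h
    rw [F.dn_lt_iff hbc h2.symm h3.symm h4] at h
    linarith
  by_cases hn : RU.Nonempty
  · obtain ⟨r, hr, hmax⟩ := RU.exists_max_image (fun r => F.T b c r) hn
    obtain ⟨h1, h2, h3, h4⟩ := Finset.mem_filter.1 hr
    refine ⟨r, h1, h2, h3, hkey r h1 h2 h3 ?_⟩
    intro r' hr' h1' h2'
    rcases hcase r' hr' h1' h2' with h | h
    · exact lowU r' h _ (hmax r' h)
    · exact lowD r' h _ ((hU r hr).trans (hD r' h))
  · have hnD : RD.Nonempty := by
      obtain ⟨r, hr, h1, h2⟩ := hne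
      rcases hcase r hr h1 h2 with h | h
      · exact absurd ⟨r, h⟩ hn
      · exact ⟨r, h⟩
    obtain ⟨r, hr, hmin⟩ := RD.exists_min_image (fun r => F.T b c r) hnD
    obtain ⟨h1, h2, h3, h4⟩ := Finset.mem_filter.1 hr
    refine ⟨r, h1, h2, h3, hkey r h1 h2 h3 ?_⟩
    intro r' hr' h1' h2'
    rcases hcase r' hr' h1' h2' with h | h
    · exact absurd ⟨r', h⟩ hn
    · exact lowD r' h _ (hmin r' h)

theorem ev_half {R : Finset α} {a b c a' c' : α} (h1' : F.prec a' b) (h2' : F.prec b c')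
    (ha' : a' ∈ R) (hc' : c' ∈ R) {x y z : ℝ} (hb : F.s b x y = z)
    (hR : ∀ r ∈ R, z ≤ F.s r x y) :
    (F.Up b c' a' → F.T b c' a' ≤ x) ∧ (F.Dn b c' a' → x ≤ F.T b c' a') ∧
    F.phi b c' x ≤ y ∧ y ≤ F.phi a' b x := by
  have e1 : F.phi b c' x ≤ y := by
    by_contra h
    push Not at h
    have := (h2'.gt_iff x y).2 h
    linarith [hR c' hc']
  have e2 : y ≤ F.phi a' b x := by
    by_contra h
    push Not at h
    have := (h1'.lt_iff x y).2 h
    linarith [hR a' ha']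
  have e3 : F.s b x (F.phi b c' x) ≤ F.s a' x (F.phi b c' x) := by
    by_contra h
    push Not at h
    rw [h1'.lt_iff] at h
    linarith
  have hac : a' ≠ c' := (F.prec_trans h1' h2').1
  refine ⟨fun h => ?_, fun h => ?_, e1, e2⟩
  · by_contra hlt
    push Not at hlt
    linarith [h.1 x hlt]
  · by_contra hlt
    push Not at hlt
    linarith [h.2 x hlt]

theorem ev_inj {R : Finset α} {a b c a' c' : α} (h1 : F.prec a b) (h2 : F.prec b c)
    (h1' : F.prec a' b) (h2' : F.prec b c') (ha : a ∈ R) (hc : c ∈ R) (ha' : a' ∈ R) (hc' : c' ∈ R)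
    (hE : F.OnEnv R {a, b, c}) (hE' : F.OnEnv R {a', b, c'})
    (ht : F.Up b c a ↔ F.Up b c' a') : a = a' ∧ c = c' := by
  obtain ⟨x, y, z, hz, hR⟩ := hE
  obtain ⟨x', y', z', hz', hR'⟩ := hE'
  have za := hz a (by simp)
  have zb := hz b (by simp)
  have zc := hz c (by simp)
  have za' := hz' a' (by simp)
  have zb' := hz' b (by simp)
  have zc' := hz' c' (by simp)
  have hac := (F.prec_trans h1 h2).1
  have hac' := (F.prec_trans h1' h2').1
  have ex : x = F.T b c a := by
    have hy := (F.phi_iff b c h2.1 x y).1 (by linarith)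
    subst hy
    exact F.T_unique h2.1 h1.1.symm hac.symm (by linarith)
  have ex' : x' = F.T b c' a' := by
    have hy := (F.phi_iff b c' h2'.1 x' y').1 (by linarith)
    subst hy
    exact F.T_unique h2'.1 h1'.1.symm hac'.symm (by linarith)
  obtain ⟨p1, p2, p3, p4⟩ := F.ev_half (a := a') (c := c') h1' h2' ha' hc' zb hR
  obtain ⟨q1, q2, q3, q4⟩ := F.ev_half (a := a) (c := c) h1 h2 ha hc zb' hR'
  have hxx : x = x' := by
    rcases F.up_or_dn h2.1 h1.1.symm hac.symm with h | h
    · have h' := ht.1 h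
      have := p1 h'
      have := q1 h
      linarith
    · have h' : F.Dn b c' a' := by
        rcases F.up_or_dn h2'.1 h1'.1.symm hac'.symm with h3 | h3
        · exact (F.up_dn_false (ht.2 h3) h).elim
        · exact h3
      have := p2 h'
      have := q2 h
      linarith
  subst hxx
  have hy' := (F.phi_iff b c' h2'.1 x y').1 (by linarith)
  have hy'' := (F.phi_iff a' b h1'.1 x y').1 (by linarith)
  have hyy : y = y' := by linarith
  subst hyy
  constructor
  · by_contra hne
    have hca' : a' ≠ c := (F.prec_trans h1' h2).1
    exact F.four a b c a' h1.1 hac hne h2.1 h1'.1.symm hca'.symm x y (by linarith) (by linarith) (by linarith)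
  · by_contra hne
    have hca' : a ≠ c' := (F.prec_trans h1 h2').1
    exact F.four a b c c' h1.1 hac hca' h2.1 h2'.1 hne x y (by linarith) (by linarith) (by linarith)

theorem env_bound [Fintype α] (R : Finset α) :
    (Finset.univ.filter fun q : α × α => q.1 ∈ R ∧ q.2 ∈ R ∧ q.1 ≠ q.2 ∧
      ∃ x, ∀ r ∈ R, F.s q.1 x (F.phi q.1 q.2 x) ≤ F.s r x (F.phi q.1 q.2 x)).card ≤ 12 * R.card := by
  set Env := (Finset.univ.filter fun q : α × α => q.1 ∈ R ∧ q.2 ∈ R ∧ q.1 ≠ q.2 ∧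
      ∃ x, ∀ r ∈ R, F.s q.1 x (F.phi q.1 q.2 x) ≤ F.s r x (F.phi q.1 q.2 x)) with hEnv
  by_cases hR : R.card ≤ 2
  · have : Env ⊆ R ×ˢ R := by
      intro q hq
      have := (Finset.mem_filter.1 hq).2
      exact Finset.mem_product.2 ⟨this.1, this.2.1⟩
    have h := Finset.card_le_card this
    rw [Finset.card_product] at h
    nlinarith
  · push Not at hR
    set EV := (Finset.univ.filter fun t : α × α × α => t.1 ∈ R ∧ t.2.1 ∈ R ∧ t.2.2 ∈ R ∧
      F.prec t.1 t.2.1 ∧ F.prec t.2.1 t.2.2 ∧ F.OnEnv R {t.1, t.2.1, t.2.2}) with hEV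
    have hEVc : EV.card ≤ R.card * 2 := by
      have : (R ×ˢ (Finset.univ : Finset Bool)).card = R.card * 2 := by
        rw [Finset.card_product]; rfl
      rw [← this]
      apply Finset.card_le_card_of_injOn (fun t => (t.2.1, decide (F.Up t.2.1 t.2.2 t.1)))
      · intro t ht
        have := (Finset.mem_filter.1 ht).2
        exact Finset.mem_product.2 ⟨this.2.1, Finset.mem_univ _⟩
      · rintro ⟨a, b, c⟩ ht ⟨a', b', c'⟩ ht' h
        have g := (Finset.mem_filter.1 ht).2
        have g' := (Finset.mem_filter.1 ht').2
        simp only [Prod.mk.injEq, decide_eq_decide] at h g g'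
        obtain ⟨rfl, h⟩ := h
        obtain ⟨e1, e2⟩ := F.ev_inj g.2.2.2.1 g.2.2.2.2.1 g'.2.2.2.1 g'.2.2.2.2.1 g.1 g.2.2.1
          g'.1 g'.2.2.1 g.2.2.2.2.2 g'.2.2.2.2.2 h
        rw [e1, e2]
    have hsub : Env ⊆ EV.biUnion (fun t => ({t.1, t.2.1, t.2.2} : Finset α).offDiag) := by
      rintro ⟨b, c⟩ hq
      obtain ⟨hb, hc, hbc, x, hx⟩ := (Finset.mem_filter.1 hq).2
      simp only at hb hc hbc hx
      have hne : ∃ r ∈ R, r ≠ b ∧ r ≠ c := by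
        by_contra hcon
        push Not at hcon
        have : R ⊆ {b, c} := by
          intro r hr
          have := hcon r hr
          simp only [Finset.mem_insert, Finset.mem_singleton]
          tauto
        have := (Finset.card_le_card this).trans Finset.card_le_two
        omega
      obtain ⟨r, hr, hrb, hrc, hE⟩ := F.env_vertex hbc hx hne
      obtain ⟨a', b', c', p1, p2, hS⟩ := F.sort3 hbc hrb.symm hrc.symm
      have hm : ∀ u ∈ ({a', b', c'} : Finset α), u ∈ R := by
        intro u hu
        rw [hS] at hu
        simp only [Finset.mem_insert, Finset.mem_singleton] at hu
        rcases hu with rfl | rfl | rfl <;> assumption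
      rw [Finset.mem_biUnion]
      refine ⟨(a', b', c'), ?_, ?_⟩
      · refine Finset.mem_filter.2 ⟨Finset.mem_univ _, hm _ (by simp), hm _ (by simp),
          hm _ (by simp), p1, p2, ?_⟩
        simp only
        rw [hS]; exact hE
      · simp only
        rw [hS, Finset.mem_offDiag]
        simp [hbc]
    have h6 : ∀ t ∈ EV, (({t.1, t.2.1, t.2.2} : Finset α).offDiag).card ≤ 6 := by
      intro t _
      rw [Finset.offDiag_card]
      have h3 : ({t.1, t.2.1, t.2.2} : Finset α).card ≤ 3 := Finset.card_le_three
      set m := ({t.1, t.2.1, t.2.2} : Finset α).card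
      interval_cases m <;> norm_num
    have := (Finset.card_le_card hsub).trans (Finset.card_biUnion_le_card_mul _ _ 6 h6)
    omega

/-- active pairs -/
def Act [Fintype α] (k : ℕ) : Finset (α × α) :=
  Finset.univ.filter fun q => q.1 ≠ q.2 ∧ ∃ a, F.Vk k {a, q.1, q.2}

theorem act_bound [Fintype α] (k : ℕ) (hk : 1 ≤ k) :
    ((F.Act k).card : ℝ) ≤ 48 * Fintype.card α * k := by
  have hw : ∀ q : α × α, ∃ p : ℝ × ℝ × ℝ, q ∈ F.Act k → F.s q.1 p.1 p.2.1 = p.2.2 ∧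
      F.s q.2 p.1 p.2.1 = p.2.2 ∧ (Finset.univ.filter fun a => F.s a p.1 p.2.1 < p.2.2).card = k := by
    intro q
    by_cases hq : q ∈ F.Act k
    · obtain ⟨hne, a, x, y, z, hz, hl⟩ := (Finset.mem_filter.1 hq).2
      exact ⟨(x, y, z), fun _ => ⟨hz _ (by simp), hz _ (by simp), hl⟩⟩
    · exact ⟨0, fun h => absurd h hq⟩
  choose p hp using hw
  have := clarkson_shor (Finset.univ : Finset α) (F.Act k) (fun q => {q.1, q.2})
    (fun q => Finset.univ.filter fun a => F.s a (p q).1 (p q).2.1 < (p q).2.2) (by simp) (by simp)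
    (by
      intro q hq
      obtain ⟨h1, h2, h3⟩ := hp q hq
      rw [Finset.disjoint_left]
      intro a ha ha'
      have := (Finset.mem_filter.1 ha').2
      simp only [Finset.mem_insert, Finset.mem_singleton] at ha
      rcases ha with rfl | rfl <;> linarith) k hk
    (by
      intro q hq
      exact Finset.card_pair (Finset.mem_filter.1 hq).2.1)
    (by
      intro q hq
      exact (hp q hq).2.2.le) 12 0
    (by
      intro R _
      have h := F.env_bound R
      have hs : ((F.Act k).filter fun t => ({t.1, t.2} : Finset α) ⊆ R ∧
          Disjoint (Finset.univ.filter fun a => F.s a (p t).1 (p t).2.1 < (p t).2.2) R) ⊆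
          (Finset.univ.filter fun q : α × α => q.1 ∈ R ∧ q.2 ∈ R ∧ q.1 ≠ q.2 ∧
      ∃ x, ∀ r ∈ R, F.s q.1 x (F.phi q.1 q.2 x) ≤ F.s r x (F.phi q.1 q.2 x)) := by
        intro q hq
        obtain ⟨hA, hD, hK⟩ := Finset.mem_filter.1 hq
        obtain ⟨h1, h2, h3⟩ := hp q hA
        have hne := (Finset.mem_filter.1 hA).2.1
        refine Finset.mem_filter.2 ⟨Finset.mem_univ _, hD (by simp), hD (by simp), hne, (p q).1, ?_⟩
        intro r hr
        have hy := (F.phi_iff _ _ hne _ _).1 (h1.trans h2.symm)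
        rw [← hy, h1]
        by_contra hlt
        push Not at hlt
        exact Finset.disjoint_left.1 hK (Finset.mem_filter.2 ⟨Finset.mem_univ _, hlt⟩) hr
      have h2 := (Finset.card_le_card hs).trans h
      rw [add_zero]
      exact_mod_cast h2)
  rw [Finset.card_univ] at this
  linarith

end Fam
end PPk

namespace PPk

section link
variable {α : Type}

structure Arr (V : Finset α) (key : α → ℝ) (f : α → ℝ → ℝ) (X : α → α → ℝ) : Prop where
  kinj : ∀ b ∈ V, ∀ c ∈ V, key b = key c → b = c
  lt_iff : ∀ b ∈ V, ∀ c ∈ V, key b < key c → ∀ x, f b x < f c x ↔ x < X b c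
  gt_iff : ∀ b ∈ V, ∀ c ∈ V, key b < key c → ∀ x, f c x < f b x ↔ X b c < x
  conc : ∀ b ∈ V, ∀ c ∈ V, ∀ d ∈ V, b ≠ c → b ≠ d → c ≠ d → ∀ x, f b x = f c x → f b x = f d x → False

def Opp (u v w : ℝ) : Prop := (u < v ∧ v < w) ∨ (w < v ∧ v < u)

/-- diamond -/
def Dia (f : α → ℝ → ℝ) (X : α → α → ℝ) (b c d e : α) : Prop :=
  Opp (f d (X b c)) (f b (X b c)) (f e (X b c)) ∧ Opp (f b (X d e)) (f d (X d e)) (f c (X d e))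

variable {V : Finset α} {key : α → ℝ} {f : α → ℝ → ℝ} {X : α → α → ℝ}

theorem Arr.refl (h : Arr V key f X) : Arr V key (fun b x => - f b (-x)) (fun b c => - X b c) where
  kinj := h.kinj
  lt_iff := by
    intro b hb c hc hk x
    rw [neg_lt_neg_iff, h.gt_iff b hb c hc hk, lt_neg]
  gt_iff := by
    intro b hb c hc hk x
    rw [neg_lt_neg_iff, h.lt_iff b hb c hc hk, neg_lt]
  conc := by
    intro b hb c hc d hd h1 h2 h3 x e1 e2
    exact h.conc b hb c hc d hd h1 h2 h3 (-x) (neg_injective e1) (neg_injective e2)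

theorem Dia.refl {b c d e : α} (h : Dia (fun b x => - f b (-x)) (fun b c => - X b c) b c d e) :
    Dia f X b c d e := by
  unfold Dia Opp at *
  simp only [neg_neg, neg_lt_neg_iff] at h
  tauto

theorem Arr.mono3 (h : Arr V key f X) {i j k : α} (hi : i ∈ V) (hj : j ∈ V) (hk : k ∈ V)
    (h1 : key i < key j) (h2 : key j < key k) :
    (X i j < X i k ∧ X i k < X j k) ∨ (X j k < X i k ∧ X i k < X i j) := by
  have hik := h1.trans h2
  have e : f i (X i k) = f k (X i k) := by
    apply le_antisymm
    · by_contra hc; push Not at hc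
      rw [h.gt_iff i hi k hk hik] at hc; exact lt_irrefl _ hc
    · by_contra hc; push Not at hc
      rw [h.lt_iff i hi k hk hik] at hc; exact lt_irrefl _ hc
  rcases lt_trichotomy (f i (X i k)) (f j (X i k)) with g | g | g
  · right
    have g' := g
    rw [e] at g'
    exact ⟨(h.gt_iff j hj k hk h2 _).1 g', (h.lt_iff i hi j hj h1 _).1 g⟩
  · exfalso
    exact h.conc i hi j hj k hk (fun hh => by subst hh; exact lt_irrefl _ h1)
      (fun hh => by subst hh; exact lt_irrefl _ hik) (fun hh => by subst hh; exact lt_irrefl _ h2)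
      _ g e
  · left
    have g' := g
    rw [e] at g'
    exact ⟨(h.gt_iff i hi j hj h1 _).1 g, (h.lt_iff j hj k hk h2 _).1 g'⟩

theorem Arr.X_inj (h : Arr V key f X) {b c d : α} (hb : b ∈ V) (hc : c ∈ V) (hd : d ∈ V)
    (h1 : key b < key c) (h2 : key b < key d) (e : X b c = X b d) : c = d := by
  rcases lt_trichotomy (key c) (key d) with g | g | g
  · rcases h.mono3 hb hc hd h1 g with h3 | h3 <;> linarith [h3.1, h3.2]
  · exact h.kinj c hc d hd g
  · rcases h.mono3 hb hd hc h2 g with h3 | h3 <;> linarith [h3.1, h3.2]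

theorem Arr.dia_key (h : Arr V key f X) {b b' w c d' : α} (hb : b ∈ V) (hb' : b' ∈ V) (hw : w ∈ V)
    (hc : c ∈ V) (hd' : d' ∈ V) (k1 : key b < key b') (k2 : key b' < key w)
    (k3 : w = c ∨ key w < key c) (k4 : w = d' ∨ key w < key d')
    (x1 : X b b' < X b c) (x2 : w = c ∨ X b c < X b w) (x3 : w = d' ∨ X b' w < X b' d')
    (hn : ¬ (w = c ∧ w = d')) : Dia f X b c b' d' := by
  have k1w := k1.trans k2
  have hbw : X b b' < X b w := by
    rcases x2 with rfl | x2
    · exact x1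
    · linarith
  have m1 : X b w < X b' w := by
    rcases h.mono3 hb hb' hw k1 k2 with m | m
    · exact m.2
    · linarith [m.2]
  have kb'c : key b' < key c := by
    rcases k3 with rfl | k3
    · exact k2
    · linarith
  have kb'd : key b' < key d' := by
    rcases k4 with rfl | k4
    · exact k2
    · linarith
  have m2 : X b c < X b' c := by
    rcases h.mono3 hb hb' hc k1 kb'c with m | m
    · exact m.2
    · linarith [m.2]
  -- facts when w < c
  have wc : key w < key c → X b c < X b w → X w c < X b w ∧ X b' c < X b' w := by
    intro k x
    have h1 : X w c < X b c := by
      rcases h.mono3 hb hw hc k1w k with m | m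
      · linarith [m.1]
      · exact m.1
    refine ⟨by linarith, ?_⟩
    rcases h.mono3 hb' hw hc k2 k with m | m
    · linarith [m.1, m.2]
    · exact m.2
  have wd : key w < key d' → X b' w < X b' d' → X b' w < X w d' ∧ X b w < X b d' := by
    intro k x
    have h1 : X b' d' < X w d' := by
      rcases h.mono3 hb' hw hd' k2 k with m | m
      · exact m.2
      · linarith [m.2]
    refine ⟨by linarith, ?_⟩
    rcases h.mono3 hb hw hd' k1w k with m | m
    · exact m.1
    · linarith [m.1, m.2]
  have c1 : X b' c < X b' d' := by
    rcases k3 with rfl | k3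
    · rcases x3 with rfl | x3
      · exact absurd ⟨rfl, rfl⟩ hn
      · exact x3
    · rcases x2 with rfl | x2
      · exact absurd k3 (lt_irrefl _)
      · have := (wc k3 x2).2
        rcases x3 with rfl | x3
        · exact this
        · linarith
  have c2 : X b c < X b d' := by
    rcases k4 with rfl | k4
    · rcases x2 with rfl | x2
      · exact absurd ⟨rfl, rfl⟩ hn
      · exact x2
    · rcases x3 with rfl | x3
      · exact absurd k4 (lt_irrefl _)
      · have := (wd k4 x3).2
        rcases x2 with rfl | x2
        · exact this
        · linarith
  refine ⟨Or.inl ⟨?_, ?_⟩, Or.inr ⟨?_, ?_⟩⟩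
  · exact (h.gt_iff b hb b' hb' k1 _).2 x1
  · exact (h.lt_iff b hb d' hd' (k1.trans kb'd) _).2 c2
  · exact (h.gt_iff b' hb' c hc kb'c _).2 c1
  · exact (h.gt_iff b hb b' hb' k1 _).2 (by linarith)

/-- the charge relation -/
def Qr (V : Finset α) (key : α → ℝ) (X : α → α → ℝ) (E : Finset (α × α)) (b c d w : α) : Prop :=
  (b, d) ∈ E ∧ X b c < X b d ∧ (∀ d', (b, d') ∈ E → X b d' ≤ X b c ∨ X b d ≤ X b d') ∧
  w ∈ V ∧ key b < key w ∧ X b c ≤ X b w ∧ X b w ≤ X b d ∧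
  ∀ w' ∈ V, key b < key w' → X b c ≤ X b w' → X b w' ≤ X b d → key w ≤ key w'

def Ty (i : Fin 3) (c d w : α) : Prop :=
  (i = 0 ∧ w = c) ∨ (i = 1 ∧ w = d) ∨ (i = 2 ∧ w ≠ c ∧ w ≠ d)

theorem Arr.charge_b (h : Arr V key f X) {E : Finset (α × α)}
    (hE : ∀ p ∈ E, p.1 ∈ V ∧ p.2 ∈ V ∧ key p.1 < key p.2)
    (hno : ∀ p ∈ E, ∀ q ∈ E, ¬ Dia f X p.1 p.2 q.1 q.2)
    {b c d b' c' d' w : α} {i : Fin 3} (hbc : (b, c) ∈ E) (hbc' : (b', c') ∈ E)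
    (hQ : Qr V key X E b c d w) (hQ' : Qr V key X E b' c' d' w)
    (ht : Ty i c d w) (ht' : Ty i c' d' w) (hlt : key b < key b') : False := by
  obtain ⟨q1, q2, q3, q4, q5, q6, q7, q8⟩ := hQ
  obtain ⟨r1, r2, r3, r4, r5, r6, r7, r8⟩ := hQ'
  obtain ⟨hb, hc, kbc⟩ := hE _ hbc
  obtain ⟨-, hd, kbd⟩ := hE _ q1
  obtain ⟨hb', hc', kbc'⟩ := hE _ hbc'
  obtain ⟨-, hd', kbd'⟩ := hE _ r1
  simp only at hb hc kbc hd kbd hb' hc' kbc' hd' kbd'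
  have le : ∀ {u v : α}, u ∈ V → v ∈ V → key u ≤ key v → u = v ∨ key u < key v := by
    intro u v hu hv huv
    rcases lt_or_eq_of_le huv with g | g
    · exact Or.inr g
    · exact Or.inl (h.kinj u hu v hv g)
  have wc := le q4 hc (q8 c hc kbc le_rfl q2.le)
  have wd := le q4 hd (q8 d hd kbd q2.le le_rfl)
  have wc' := le q4 hc' (r8 c' hc' kbc' le_rfl r2.le)
  have wd' := le q4 hd' (r8 d' hd' kbd' r2.le le_rfl)
  have xs : ∀ {u v1 v2 : α}, u ∈ V → v1 ∈ V → v2 ∈ V → key u < key v1 → key u < key v2 →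
      X u v1 ≤ X u v2 → v1 = v2 ∨ X u v1 < X u v2 := by
    intro u v1 v2 h1 h2 h3 h4 h5 h6
    rcases lt_or_eq_of_le h6 with g | g
    · exact Or.inr g
    · exact Or.inl (h.X_inj h1 h2 h3 h4 h5 g)
  have hcd : c ≠ d := fun hh => by subst hh; exact lt_irrefl _ q2
  have hcd' : c' ≠ d' := fun hh => by subst hh; exact lt_irrefl _ r2
  by_cases hx : X b b' < X b c
  · refine hno _ hbc _ r1 (h.dia_key hb hb' q4 hc hd' hlt r5 wc wd' hx ?_ ?_ ?_)
    · rcases xs hb hc q4 kbc q5 q6 with g | g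
      · exact Or.inl g.symm
      · exact Or.inr g
    · exact xs hb' q4 hd' r5 kbd' r7
    · rintro ⟨g1, g2⟩
      rcases ht with ⟨t1, t2⟩ | ⟨t1, t2⟩ | ⟨t1, t2, t3⟩
      · rcases ht' with ⟨s1, s2⟩ | ⟨s1, s2⟩ | ⟨s1, s2, s3⟩
        · exact hcd' (s2.symm.trans g2)
        · rw [t1] at s1; exact absurd s1 (by decide)
        · rw [t1] at s1; exact absurd s1 (by decide)
      · exact hcd (g1.symm.trans t2)
      · exact t2 g1
  · by_cases hx2 : X b d < X b b'
    · have h' := h.refl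
      refine hno _ q1 _ hbc' (Dia.refl (h'.dia_key hb hb' q4 hd hc' hlt r5 wd wc' ?_ ?_ ?_ ?_))
      · exact neg_lt_neg hx2
      · rcases xs hb q4 hd q5 kbd q7 with g | g
        · exact Or.inl g
        · exact Or.inr (neg_lt_neg g)
      · rcases xs hb' hc' q4 kbc' r5 r6 with g | g
        · exact Or.inl g.symm
        · exact Or.inr (neg_lt_neg g)
      · rintro ⟨g1, g2⟩
        rcases ht with ⟨t1, t2⟩ | ⟨t1, t2⟩ | ⟨t1, t2, t3⟩
        · exact hcd (t2.symm.trans g1)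
        · rcases ht' with ⟨s1, s2⟩ | ⟨s1, s2⟩ | ⟨s1, s2, s3⟩
          · rw [t1] at s1; exact absurd s1 (by decide)
          · exact hcd' (g2.symm.trans s2)
          · rw [t1] at s1; exact absurd s1 (by decide)
        · exact t3 g1
    · push Not at hx hx2
      have := q8 b' hb' hlt hx hx2
      linarith

theorem Arr.charge (h : Arr V key f X) {E : Finset (α × α)}
    (hE : ∀ p ∈ E, p.1 ∈ V ∧ p.2 ∈ V ∧ key p.1 < key p.2)
    (hno : ∀ p ∈ E, ∀ q ∈ E, ¬ Dia f X p.1 p.2 q.1 q.2)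
    {b c d b' c' d' w : α} {i : Fin 3} (hbc : (b, c) ∈ E) (hbc' : (b', c') ∈ E)
    (hQ : Qr V key X E b c d w) (hQ' : Qr V key X E b' c' d' w)
    (ht : Ty i c d w) (ht' : Ty i c' d' w) : (b, c) = (b', c') := by
  obtain ⟨hb, hc, kbc⟩ := hE _ hbc
  obtain ⟨hb', hc', kbc'⟩ := hE _ hbc'
  simp only at hb hc kbc hb' hc' kbc'
  rcases lt_trichotomy (key b) (key b') with hlt | heq | hlt
  · exact (h.charge_b hE hno hbc hbc' hQ hQ' ht ht' hlt).elim
  · have := h.kinj b hb b' hb' heq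
    subst this
    congr 1
    obtain ⟨q1, q2, q3, q4, q5, q6, q7, q8⟩ := hQ
    obtain ⟨r1, r2, r3, r4, r5, r6, r7, r8⟩ := hQ'
    obtain ⟨-, hd, kbd⟩ := hE _ q1
    obtain ⟨-, hd', kbd'⟩ := hE _ r1
    simp only at hd kbd hd' kbd'
    have a1 := q3 c' hbc'
    have a2 := r3 c hbc
    have a3 := q3 d' r1
    have a4 := r3 d q1
    have fin : X b c = X b c' → c = c' := fun e => h.X_inj hb hc hc' kbc kbc' e
    rcases ht with ⟨t1, t2⟩ | ⟨t1, t2⟩ | ⟨t1, t2, t3⟩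
    · rcases ht' with ⟨s1, s2⟩ | ⟨s1, s2⟩ | ⟨s1, s2, s3⟩
      · exact t2.symm.trans s2
      · rw [t1] at s1; exact absurd s1 (by decide)
      · rw [t1] at s1; exact absurd s1 (by decide)
    · rcases ht' with ⟨s1, s2⟩ | ⟨s1, s2⟩ | ⟨s1, s2, s3⟩
      · rw [t1] at s1; exact absurd s1 (by decide)
      · have hdd : d = d' := t2.symm.trans s2
        subst hdd
        apply fin
        rcases a1 with a1 | a1 <;> rcases a2 with a2 | a2 <;> linarith
      · rw [t1] at s1; exact absurd s1 (by decide)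
    · rcases ht' with ⟨s1, s2⟩ | ⟨s1, s2⟩ | ⟨s1, s2, s3⟩
      · rw [t1] at s1; exact absurd s1 (by decide)
      · rw [t1] at s1; exact absurd s1 (by decide)
      · have e1 : X b c < X b w := lt_of_le_of_ne q6
          (fun e => t2 (h.X_inj hb hc q4 kbc q5 e).symm)
        have e3 : X b c' < X b w := lt_of_le_of_ne r6
          (fun e => s2 (h.X_inj hb hc' q4 kbc' q5 e).symm)
        apply fin
        rcases a1 with a1 | a1 <;> rcases a2 with a2 | a2 <;> linarith
  · exact (h.charge_b hE hno hbc' hbc hQ' hQ ht' ht hlt).elim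

theorem Arr.no_dia_bound (h : Arr V key f X) {E : Finset (α × α)}
    (hE : ∀ p ∈ E, p.1 ∈ V ∧ p.2 ∈ V ∧ key p.1 < key p.2)
    (hno : ∀ p ∈ E, ∀ q ∈ E, ¬ Dia f X p.1 p.2 q.1 q.2) : E.card ≤ 4 * V.card := by
  set L := E.filter (fun p => ∀ d, (p.1, d) ∈ E → X p.1 d ≤ X p.1 p.2) with hL
  set M := E.filter (fun p => ¬ ∀ d, (p.1, d) ∈ E → X p.1 d ≤ X p.1 p.2) with hM
  have hLc : L.card ≤ V.card := by
    apply Finset.card_le_card_of_injOn (fun p => p.1)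
    · intro p hp
      exact (hE p (Finset.mem_filter.1 hp).1).1
    · rintro ⟨b, c⟩ hp ⟨b', c'⟩ hp' e
      simp only at e
      subst e
      obtain ⟨h1, h2⟩ := Finset.mem_filter.1 hp
      obtain ⟨h1', h2'⟩ := Finset.mem_filter.1 hp'
      have e1 := h2 c' h1'
      have e2 := h2' c h1
      simp only at e1 e2
      obtain ⟨hb, hc, kbc⟩ := hE _ h1
      obtain ⟨-, hc', kbc'⟩ := hE _ h1'
      have ee : c = c' := h.X_inj hb hc hc' kbc kbc' (le_antisymm e2 e1)
      rw [ee]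
  have hex : ∀ p : α × α, ∃ r : Fin 3 × α, p ∈ M → r.2 ∈ V ∧
      ∃ d, Qr V key X E p.1 p.2 d r.2 ∧ Ty r.1 p.2 d r.2 := by
    rintro ⟨b, c⟩
    by_cases hp : (b, c) ∈ M
    swap
    · exact ⟨(0, b), fun hh => absurd hh hp⟩
    obtain ⟨h1, h2⟩ := Finset.mem_filter.1 hp
    push Not at h2
    simp only at h2
    obtain ⟨d0, hd0, hx0⟩ := h2
    obtain ⟨⟨b1, d⟩, hq, hmin⟩ := (E.filter (fun q => q.1 = b ∧ X b c < X b q.2)).exists_min_image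
      (fun q => X b q.2) ⟨(b, d0), Finset.mem_filter.2 ⟨hd0, rfl, hx0⟩⟩
    obtain ⟨hqE, hqb, hqx⟩ := Finset.mem_filter.1 hq
    simp only at hqb hqx
    subst hqb
    obtain ⟨hb, hc, kbc⟩ := hE _ h1
    obtain ⟨-, hd, kbd⟩ := hE _ hqE
    simp only at hb hc kbc hd kbd
    obtain ⟨w, hw, hwmin⟩ := (V.filter (fun w => key b1 < key w ∧ X b1 c ≤ X b1 w ∧
      X b1 w ≤ X b1 d)).exists_min_image key ⟨c, Finset.mem_filter.2 ⟨hc, kbc, le_rfl, hqx.le⟩⟩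
    obtain ⟨hwV, kw, xw1, xw2⟩ := Finset.mem_filter.1 hw
    have hQ : Qr V key X E b1 c d w := by
      refine ⟨hqE, hqx, ?_, hwV, kw, xw1, xw2, ?_⟩
      · intro d' hd'
        by_cases g : X b1 c < X b1 d'
        · right; exact hmin (b1, d') (Finset.mem_filter.2 ⟨hd', rfl, g⟩)
        · left; linarith
      · intro w' hw' g1 g2 g3
        exact hwmin w' (Finset.mem_filter.2 ⟨hw', g1, g2, g3⟩)
    by_cases g1 : w = c
    · exact ⟨(0, w), fun _ => ⟨hwV, d, hQ, Or.inl ⟨rfl, g1⟩⟩⟩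
    by_cases g2 : w = d
    · exact ⟨(1, w), fun _ => ⟨hwV, d, hQ, Or.inr (Or.inl ⟨rfl, g2⟩)⟩⟩
    · exact ⟨(2, w), fun _ => ⟨hwV, d, hQ, Or.inr (Or.inr ⟨rfl, g1, g2⟩)⟩⟩
  choose r hr using hex
  have hMc : M.card ≤ 3 * V.card := by
    have : ((Finset.univ : Finset (Fin 3)) ×ˢ V).card = 3 * V.card := by
      rw [Finset.card_product]; simp
    rw [← this]
    apply Finset.card_le_card_of_injOn r
    · intro p hp
      exact Finset.mem_product.2 ⟨Finset.mem_univ _, (hr p hp).1⟩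
    · rintro ⟨b, c⟩ hp ⟨b', c'⟩ hp' e
      obtain ⟨-, d, hQ, ht⟩ := hr _ hp
      obtain ⟨-, d', hQ', ht'⟩ := hr _ hp'
      rw [← e] at hQ' ht'
      exact h.charge hE hno (Finset.mem_filter.1 hp).1 (Finset.mem_filter.1 hp').1 hQ hQ' ht ht'
  have hsum := Finset.card_filter_add_card_filter_not (s := E)
    (fun p => ∀ d, (p.1, d) ∈ E → X p.1 d ≤ X p.1 p.2)
  rw [← hL, ← hM] at hsum
  omega

theorem Arr.dia_bound (h : Arr V key f X) {E : Finset (α × α)}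
    (hE : ∀ p ∈ E, p.1 ∈ V ∧ p.2 ∈ V ∧ key p.1 < key p.2) :
    E.card ≤ 4 * V.card + ((E ×ˢ E).filter fun m => Dia f X m.1.1 m.1.2 m.2.1 m.2.2).card := by
  set M := (E ×ˢ E).filter fun m => Dia f X m.1.1 m.1.2 m.2.1 m.2.2 with hM
  have h1 := h.no_dia_bound (E := E \ M.image Prod.fst)
    (fun p hp => hE p (Finset.mem_sdiff.1 hp).1)
    (by
      intro p hp q hq hd
      refine (Finset.mem_sdiff.1 hp).2 (Finset.mem_image.2 ⟨(p, q), ?_, rfl⟩)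
      exact Finset.mem_filter.2 ⟨Finset.mem_product.2 ⟨(Finset.mem_sdiff.1 hp).1,
        (Finset.mem_sdiff.1 hq).1⟩, hd⟩)
  have h2 : (M.image Prod.fst).card ≤ M.card := Finset.card_image_le
  have h3 := Finset.card_le_card_sdiff_add_card (s := E) (t := M.image Prod.fst)
  omega

theorem Arr.sub (h : Arr V key f X) {R : Finset α} (hR : R ⊆ V) : Arr R key f X where
  kinj := fun b hb c hc => h.kinj b (hR hb) c (hR hc)
  lt_iff := fun b hb c hc => h.lt_iff b (hR hb) c (hR hc)
  gt_iff := fun b hb c hc => h.gt_iff b (hR hb) c (hR hc)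
  conc := fun b hb c hc d hd => h.conc b (hR hb) c (hR hc) d (hR hd)

theorem Arr.X_eq (h : Arr V key f X) {b c : α} (hb : b ∈ V) (hc : c ∈ V) (hk : key b < key c) :
    f b (X b c) = f c (X b c) := by
  apply le_antisymm
  · by_contra hc'; push Not at hc'
    rw [h.gt_iff b hb c hc hk] at hc'; exact lt_irrefl _ hc'
  · by_contra hc'; push Not at hc'
    rw [h.lt_iff b hb c hc hk] at hc'; exact lt_irrefl _ hc'

theorem Arr.amplified (h : Arr V key f X) {E : Finset (α × α)}
    (hE : ∀ p ∈ E, p.1 ∈ V ∧ p.2 ∈ V ∧ key p.1 < key p.2) (p : ℝ) (hp0 : 0 < p) (hp1 : p ≤ 1) :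
    p ^ 2 * E.card ≤ 4 * p * V.card +
      p ^ 4 * ((E ×ˢ E).filter fun m => Dia f X m.1.1 m.1.2 m.2.1 m.2.2).card := by
  obtain ⟨M, hM⟩ : ∃ M : Finset ((α × α) × (α × α)),
    M = (E ×ˢ E).filter fun m => Dia f X m.1.1 m.1.2 m.2.1 m.2.2 := ⟨_, rfl⟩
  rw [← hM]
  refine amplify (α := α) (ι := α × α) (κ := (α × α) × (α × α)) V E M
    (fun q => ({q.1, q.2} : Finset α)) (fun m => ({m.1.1, m.1.2, m.2.1, m.2.2} : Finset α))
    ?_ ?_ ?_ ?_ ?_ p hp0 hp1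
  all_goals subst hM
  · intro q hq u hu
    obtain ⟨h1, h2, -⟩ := hE q hq
    simp only [Finset.mem_insert, Finset.mem_singleton] at hu
    rcases hu with rfl | rfl <;> assumption
  · intro m hm u hu
    obtain ⟨hm1, -⟩ := Finset.mem_filter.1 hm
    obtain ⟨hm1, hm2⟩ := Finset.mem_product.1 hm1
    obtain ⟨h1, h2, -⟩ := hE _ hm1
    obtain ⟨h3, h4, -⟩ := hE _ hm2
    simp only [Finset.mem_insert, Finset.mem_singleton] at hu
    rcases hu with rfl | rfl | rfl | rfl <;> assumption
  · intro q hq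
    obtain ⟨h1, h2, h3⟩ := hE q hq
    exact Finset.card_pair (fun e => by rw [e] at h3; exact lt_irrefl _ h3)
  · rintro ⟨⟨b, c⟩, ⟨d, e⟩⟩ hm
    obtain ⟨hm1, hD1, hD2⟩ := Finset.mem_filter.1 hm
    obtain ⟨hm1, hm2⟩ := Finset.mem_product.1 hm1
    obtain ⟨h1, h2, h3⟩ := hE _ hm1
    obtain ⟨h4, h5, h6⟩ := hE _ hm2
    simp only at h1 h2 h3 h4 h5 h6 hD1 hD2
    have e1 := h.X_eq h1 h2 h3
    have e2 := h.X_eq h4 h5 h6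
    have n1 : b ≠ c := fun e => by rw [e] at h3; exact lt_irrefl _ h3
    have n2 : d ≠ e := fun e => by rw [e] at h6; exact lt_irrefl _ h6
    unfold Opp at hD1 hD2
    have n3 : b ≠ d := by
      rintro rfl
      rcases hD1 with g | g <;> linarith [g.1, g.2]
    have n4 : b ≠ e := by
      rintro rfl
      rcases hD1 with g | g <;> linarith [g.1, g.2]
    have n5 : c ≠ d := by
      rintro rfl
      rcases hD1 with g | g <;> linarith [g.1, g.2]
    have n6 : c ≠ e := by
      rintro rfl
      rcases hD1 with g | g <;> linarith [g.1, g.2]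
    exact Finset.card_eq_four.2 ⟨b, c, d, e, n1, n3, n4, n5, n6, n2, rfl⟩
  · intro R hR
    have h1 := (h.sub hR).dia_bound (E := E.filter fun t => ({t.1, t.2} : Finset α) ⊆ R) (by
      intro q hq
      obtain ⟨hq1, hq2⟩ := Finset.mem_filter.1 hq
      exact ⟨hq2 (by simp), hq2 (by simp), (hE q hq1).2.2⟩)
    have h2 : (((E.filter fun t => ({t.1, t.2} : Finset α) ⊆ R) ×ˢ
        (E.filter fun t => ({t.1, t.2} : Finset α) ⊆ R)).filter
        fun m => Dia f X m.1.1 m.1.2 m.2.1 m.2.2) ⊆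
        (((E ×ˢ E).filter fun m => Dia f X m.1.1 m.1.2 m.2.1 m.2.2).filter fun m =>
          ({m.1.1, m.1.2, m.2.1, m.2.2} : Finset α) ⊆ R) := by
      intro m hm
      obtain ⟨hm1, hD⟩ := Finset.mem_filter.1 hm
      obtain ⟨hm1, hm2⟩ := Finset.mem_product.1 hm1
      obtain ⟨g1, g2⟩ := Finset.mem_filter.1 hm1
      obtain ⟨g3, g4⟩ := Finset.mem_filter.1 hm2
      refine Finset.mem_filter.2 ⟨Finset.mem_filter.2 ⟨Finset.mem_product.2 ⟨g1, g3⟩, hD⟩, ?_⟩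
      intro u hu
      simp only [Finset.mem_insert, Finset.mem_singleton] at hu
      rcases hu with rfl | rfl | rfl | rfl
      · exact g2 (by simp)
      · exact g2 (by simp)
      · exact g4 (by simp)
      · exact g4 (by simp)
    have h3 := Finset.card_le_card h2
    have h4 := h1.trans (Nat.add_le_add_left h3 _)
    exact_mod_cast h4

end link
end PPk

namespace PPk
namespace Fam
variable {α : Type} (F : Fam α)

theorem link_cross {a b c : α} (hb : F.prec a b) (hc : F.prec a c) (hbc : b ≠ c) :
    (∀ x, (F.phi a b x < F.phi a c x ↔ x < F.T a b c) ∧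
      (F.phi a c x < F.phi a b x ↔ F.T a b c < x)) ∨
    (∀ x, (F.phi a b x < F.phi a c x ↔ F.T a b c < x) ∧
      (F.phi a c x < F.phi a b x ↔ x < F.T a b c)) := by
  rcases F.up_or_dn hb.1 hc.1 hbc with h | h
  · left
    intro x
    rw [← hc.gt_iff x (F.phi a b x), ← hc.lt_iff x (F.phi a b x)]
    exact ⟨F.up_lt_iff hb.1 hc.1 hbc h x, F.up_gt_iff hb.1 hc.1 hbc h x⟩
  · right
    intro x
    rw [← hc.gt_iff x (F.phi a b x), ← hc.lt_iff x (F.phi a b x)]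
    exact ⟨F.dn_lt_iff hb.1 hc.1 hbc h x, F.dn_gt_iff hb.1 hc.1 hbc h x⟩

theorem alt_UDU {b c u v w : α} (hu : F.IsU b c u) (hv : F.IsD b c v) (hw : F.IsU b c w)
    (h1 : F.T b c u < F.T b c v) (h2 : F.T b c v < F.T b c w) : F.Alt b c {u, v, w} :=
  ⟨u, w, v, ⟨⟨hw, hv, h2⟩, Or.inl ⟨hu, h1⟩⟩, by ext x; simp only [Finset.mem_insert, Finset.mem_singleton]; tauto⟩

theorem alt_DUD {b c u v w : α} (hu : F.IsD b c u) (hv : F.IsU b c v) (hw : F.IsD b c w)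
    (h1 : F.T b c u < F.T b c v) (h2 : F.T b c v < F.T b c w) : F.Alt b c {u, v, w} :=
  ⟨w, v, u, ⟨⟨hv, hu, h1⟩, Or.inr ⟨hw, h2⟩⟩, by ext x; simp only [Finset.mem_insert, Finset.mem_singleton]; tauto⟩

theorem alt_perm {b c u v w u' v' w' : α} (h : F.Alt b c {u, v, w})
    (he : ∀ x, (x = u ∨ x = v ∨ x = w) ↔ (x = u' ∨ x = v' ∨ x = w')) : F.Alt b c {u', v', w'} := by
  have : ({u, v, w} : Finset α) = {u', v', w'} := by
    ext x; simp only [Finset.mem_insert, Finset.mem_singleton]; exact he x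
  rw [← this]; exact h

theorem ud_cases {b c a : α} (hbc : b ≠ c) (h1 : a ≠ b) (h2 : a ≠ c) :
    (F.IsU b c a ∧ ∀ x, (F.s a x (F.phi b c x) < F.s b x (F.phi b c x) ↔ x < F.T b c a) ∧
      (F.s b x (F.phi b c x) < F.s a x (F.phi b c x) ↔ F.T b c a < x)) ∨
    (F.IsD b c a ∧ ∀ x, (F.s a x (F.phi b c x) < F.s b x (F.phi b c x) ↔ F.T b c a < x) ∧
      (F.s b x (F.phi b c x) < F.s a x (F.phi b c x) ↔ x < F.T b c a)) := by
  rcases F.up_or_dn hbc h1.symm h2.symm with h | h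
  · left
    exact ⟨⟨h1, h2, h⟩, fun x => ⟨F.up_lt_iff hbc h1.symm h2.symm h x, F.up_gt_iff hbc h1.symm h2.symm h x⟩⟩
  · right
    exact ⟨⟨h1, h2, h⟩, fun x => ⟨F.dn_lt_iff hbc h1.symm h2.symm h x, F.dn_gt_iff hbc h1.symm h2.symm h x⟩⟩

theorem alt_of {b c a d e : α} (hbc : b ≠ c) (ha : a ≠ b) (ha' : a ≠ c) (hd : d ≠ b) (hd' : d ≠ c)
    (he : e ≠ b) (he' : e ≠ c) {t x : ℝ} (ht : t = F.T b c a)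
    (hO : Opp (F.s d t (F.phi b c t)) (F.s b t (F.phi b c t)) (F.s e t (F.phi b c t)))
    (hx : (F.s d x (F.phi b c x) < F.s b x (F.phi b c x) ∧
        F.s e x (F.phi b c x) < F.s b x (F.phi b c x) ∧
        F.s b x (F.phi b c x) < F.s a x (F.phi b c x)) ∨
      (F.s b x (F.phi b c x) < F.s d x (F.phi b c x) ∧
        F.s b x (F.phi b c x) < F.s e x (F.phi b c x) ∧
        F.s a x (F.phi b c x) < F.s b x (F.phi b c x))) : F.Alt b c {a, d, e} := by
  unfold Opp at hO
  rcases F.ud_cases hbc ha ha' with ⟨qa, ia⟩ | ⟨qa, ia⟩ <;>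
  rcases F.ud_cases hbc hd hd' with ⟨qd, id⟩ | ⟨qd, id⟩ <;>
  rcases F.ud_cases hbc he he' with ⟨qe, ie⟩ | ⟨qe, ie⟩ <;>
  simp only [ia, id, ie] at hO hx <;>
  rw [ht] at hO <;>
  rcases hO with ⟨o1, o2⟩ | ⟨o1, o2⟩ <;> rcases hx with ⟨x1, x2, x3⟩ | ⟨x1, x2, x3⟩ <;>
  first
  | (exfalso; linarith)
  | exact F.alt_perm (F.alt_UDU qa qd qe (by linarith) (by linarith)) (by tauto)
  | exact F.alt_perm (F.alt_UDU qa qe qd (by linarith) (by linarith)) (by tauto)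
  | exact F.alt_perm (F.alt_UDU qd qa qe (by linarith) (by linarith)) (by tauto)
  | exact F.alt_perm (F.alt_UDU qd qe qa (by linarith) (by linarith)) (by tauto)
  | exact F.alt_perm (F.alt_UDU qe qa qd (by linarith) (by linarith)) (by tauto)
  | exact F.alt_perm (F.alt_UDU qe qd qa (by linarith) (by linarith)) (by tauto)
  | exact F.alt_perm (F.alt_DUD qa qd qe (by linarith) (by linarith)) (by tauto)
  | exact F.alt_perm (F.alt_DUD qa qe qd (by linarith) (by linarith)) (by tauto)
  | exact F.alt_perm (F.alt_DUD qd qa qe (by linarith) (by linarith)) (by tauto)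
  | exact F.alt_perm (F.alt_DUD qd qe qa (by linarith) (by linarith)) (by tauto)
  | exact F.alt_perm (F.alt_DUD qe qa qd (by linarith) (by linarith)) (by tauto)
  | exact F.alt_perm (F.alt_DUD qe qd qa (by linarith) (by linarith)) (by tauto)

/-- no `+ - +` pattern for a pair of link curves -/
theorem link_nopat {a b c : α} (hb : F.prec a b) (hc : F.prec a c) (hbc : b ≠ c) {x y z : ℝ}
    (h1 : F.phi a b x < F.phi a c x) (h2 : F.phi a c y < F.phi a b y)
    (h3 : F.phi a b z < F.phi a c z) : (x < y ∧ z < y) ∨ (y < x ∧ y < z) := by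
  rcases F.link_cross hb hc hbc with h | h
  · left
    have := (h x).1.1 h1
    have := (h y).2.1 h2
    have := (h z).1.1 h3
    constructor <;> linarith
  · right
    have := (h x).1.1 h1
    have := (h y).2.1 h2
    have := (h z).1.1 h3
    constructor <;> linarith

/-- key impossibility -/
theorem link_imp {a b c d e : α} (hb : F.prec a b) (hc : F.prec a c) (hd : F.prec a d)
    (he : F.prec a e) (hbd : b ≠ d) (hce : c ≠ e) (hcd : c ≠ d)
    {x y z : ℝ} (hxy : F.phi a b x = F.phi a c x) (hyy : F.phi a d y = F.phi a e y)
    (h1 : F.phi a d x < F.phi a b x) (h2 : F.phi a b x < F.phi a e x)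
    (h3 : F.phi a b y < F.phi a d y) (h4 : F.phi a d y < F.phi a c y)
    (g1 : F.phi a b z < F.phi a d z) (g3 : F.phi a c z < F.phi a d z)
    (g4 : F.phi a c z < F.phi a e z) : False := by
  have r1 := F.link_nopat hb hd hbd h3 h1 g1
  have r2 := F.link_nopat hc he hce (by linarith : F.phi a c x < F.phi a e x)
    (by linarith : F.phi a e y < F.phi a c y) g4
  have r3 := F.link_nopat hd hc hcd.symm (by linarith : F.phi a d x < F.phi a c x)
    g3 (by linarith : F.phi a d y < F.phi a c y)
  rcases r1 with r1 | r1 <;> rcases r2 with r2 | r2 <;> rcases r3 with r3 | r3 <;>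
    linarith [r1.1, r1.2, r2.1, r2.2, r3.1, r3.2]

theorem link_imp2 {a b c d e : α} (hb : F.prec a b) (hc : F.prec a c) (hd : F.prec a d)
    (he : F.prec a e) (hbd : b ≠ d) (hbe : b ≠ e) (hce : c ≠ e) (hcd : c ≠ d)
    {x y z : ℝ} (hxy : F.phi a b x = F.phi a c x) (hyy : F.phi a d y = F.phi a e y)
    (h1 : Opp (F.phi a d x) (F.phi a b x) (F.phi a e x))
    (h2 : Opp (F.phi a b y) (F.phi a d y) (F.phi a c y))
    (g1 : F.phi a b z < F.phi a d z) (g2 : F.phi a b z < F.phi a e z)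
    (g3 : F.phi a c z < F.phi a d z)
    (g4 : F.phi a c z < F.phi a e z) : False := by
  rcases h1 with ⟨h1, h1'⟩ | ⟨h1, h1'⟩ <;> rcases h2 with ⟨h2, h2'⟩ | ⟨h2, h2'⟩
  · exact F.link_imp hb hc hd he hbd hce hcd hxy hyy h1 h1' h2 h2' g1 g3 g4
  · exact F.link_imp hc hb hd he hcd hbe hbd hxy.symm hyy (by linarith) (by linarith)
      (by linarith) (by linarith) g3 g1 g2
  · exact F.link_imp hb hc he hd hbe hcd hce hxy hyy.symm (by linarith) (by linarith)
      (by linarith) (by linarith) g2 g4 g3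
  · exact F.link_imp hc hb he hd hce hbd hbe hxy.symm hyy.symm (by linarith) (by linarith)
      (by linarith) (by linarith) g4 g2 g1

theorem T_rot {a b c : α} (hab : a ≠ b) (hac : a ≠ c) (hbc : b ≠ c) :
    F.T a b c = F.T b c a := by
  rw [F.T_swap12 hab hac hbc, F.T_swap23 hab.symm hbc hac]

theorem phi_at {a b c : α} (hab : a ≠ b) (hac : a ≠ c) (hbc : b ≠ c) :
    F.phi b c (F.T a b c) = F.phi a b (F.T a b c) ∧ F.phi a b (F.T a b c) = F.phi a c (F.T a b c) := by
  have h := F.s_T hab hac hbc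
  have h' := F.s_phi hab (F.T a b c)
  exact ⟨((F.phi_iff b c hbc _ _).1 (h'.symm.trans h)).symm, (F.phi_iff a c hac _ _).1 h⟩

/-- translate the diamond condition at the vertex `abc` -/
theorem opp_tr {a b c d e : α} (hb : F.prec a b) (hc : F.prec a c) (hd : F.prec a d)
    (he : F.prec a e) (hbc : b ≠ c) {t : ℝ} (ht : t = F.T a b c)
    (h : Opp (F.phi a d t) (F.phi a b t) (F.phi a e t)) :
    Opp (F.s d t (F.phi b c t)) (F.s b t (F.phi b c t)) (F.s e t (F.phi b c t)) := by
  have h1 := (F.phi_at hb.1 hc.1 hbc).1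
  rw [← ht] at h1
  have h2 : F.s a t (F.phi a b t) = F.s b t (F.phi a b t) := F.s_phi hb.1 t
  rw [h1, ← h2]
  unfold Opp at *
  rw [← hd.lt_iff, ← he.gt_iff, ← he.lt_iff, ← hd.gt_iff] at h
  tauto

theorem claimB {a b c d e : α} (hb : F.prec a b) (hc : F.prec a c) (hd : F.prec a d)
    (he : F.prec a e) (hbc : b ≠ c) (hbd : b ≠ d) (hbe : b ≠ e) (hcd : c ≠ d) (hce : c ≠ e)
    (hde : d ≠ e) (h : Dia (F.phi a) (F.T a) b c d e) :
    F.Alt b c {a, d, e} ∨ F.Alt d e {a, b, c} := by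
  obtain ⟨h1, h2⟩ := h
  have k1 := F.opp_tr hb hc hd he hbc rfl h1
  have k2 := F.opp_tr hd he hb hc hde rfl h2
  obtain ⟨z, hz, -⟩ := F.cross b c d e hbc hde hbd hbe hcd hce
  have e1 : F.s b z (F.phi b c z) = F.s c z (F.phi b c z) := F.s_phi hbc z
  have e2 : F.s d z (F.phi b c z) = F.s e z (F.phi b c z) := by rw [hz]; exact F.s_phi hde z
  have n1 : F.s a z (F.phi b c z) ≠ F.s b z (F.phi b c z) := by
    intro hh
    have hz' : z = F.T a b c := by
      rw [F.T_rot hb.1 hc.1 hbc]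
      exact F.T_unique hbc hb.1.symm hc.1.symm hh.symm
    rw [← hz'] at k1
    rcases k1 with k | k <;> linarith [k.1, k.2]
  have n2 : F.s a z (F.phi b c z) ≠ F.s d z (F.phi b c z) := by
    intro hh
    rw [hz] at hh
    have hz' : z = F.T a d e := by
      rw [F.T_rot hd.1 he.1 hde]
      exact F.T_unique hde hd.1.symm he.1.symm hh.symm
    rw [← hz', ← hz] at k2
    rcases k2 with k | k <;> linarith [k.1, k.2]
  have n3 : F.s b z (F.phi b c z) ≠ F.s d z (F.phi b c z) := by
    intro hh
    exact F.four b c d e hbc hbd hbe hcd hce hde z _ e1 hh (hh.trans e2)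
  have A1 := fun hx => F.alt_of (x := z) hbc hb.1 hc.1 hbd.symm hcd.symm hbe.symm hce.symm
    (F.T_rot hb.1 hc.1 hbc) k1 hx
  have A2 := fun hx => F.alt_of (x := z) hde hd.1 he.1 hbd hbe hcd hce
    (F.T_rot hd.1 he.1 hde) k2 hx
  rw [← hz] at A2
  have x1 := (F.phi_at hb.1 hc.1 hbc).2
  have x2 := (F.phi_at hd.1 he.1 hde).2
  rcases lt_or_gt_of_ne n1 with m1 | m1 <;> rcases lt_or_gt_of_ne n2 with m2 | m2 <;>
    rcases lt_or_gt_of_ne n3 with m3 | m3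
  · exact Or.inl (A1 (Or.inr ⟨m3, by linarith, m1⟩))
  · exact Or.inr (A2 (Or.inr ⟨m3, by linarith, m2⟩))
  · linarith
  · exfalso
    rw [hb.lt_iff] at m1
    rw [hd.gt_iff] at m2
    have m4 : F.s a z (F.phi b c z) < F.s c z (F.phi b c z) := by
      rw [← e1]; exact (hb.lt_iff _ _).2 m1
    have m5 : F.s e z (F.phi b c z) < F.s a z (F.phi b c z) := by
      rw [← e2]; exact (hd.gt_iff _ _).2 m2
    rw [hc.lt_iff] at m4
    rw [he.gt_iff] at m5
    exact F.link_imp2 hb hc hd he hbd hbe hce hcd x1 x2 h1 h2 (m1.trans m2) (m1.trans m5)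
      (m4.trans m2) (m4.trans m5)
  · exfalso
    have m4 : F.s c z (F.phi b c z) < F.s a z (F.phi b c z) := by
      rw [← e1]; exact m1
    have m5 : F.s a z (F.phi b c z) < F.s e z (F.phi b c z) := by
      rw [← e2]; exact m2
    have m1' := (hb.gt_iff _ _).1 m1
    have m2' := (hd.lt_iff _ _).1 m2
    rw [hc.gt_iff] at m4
    rw [he.lt_iff] at m5
    exact F.link_imp2 hd he hb hc hbd.symm hcd.symm hce.symm hbe.symm x2 x1 h2 h1
      (m2'.trans m1') (m2'.trans m4) (m5.trans m1') (m5.trans m4)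
  · linarith
  · exact Or.inr (A2 (Or.inl ⟨m3, by linarith, m2⟩))
  · exact Or.inl (A1 (Or.inl ⟨m3, by linarith, m1⟩))

end Fam
end PPk

namespace PPk
namespace Fam
variable {α : Type} (F : Fam α)

theorem exists_left [Fintype α] : ∃ x0 : ℝ, ∀ a b c, x0 < F.T a b c := by
  obtain ⟨m, hm⟩ := (Finset.univ.image (fun p : α × α × α => F.T p.1 p.2.1 p.2.2)).bddBelow
  refine ⟨m - 1, fun a b c => ?_⟩
  have := hm (Finset.mem_coe.2 (Finset.mem_image.2 ⟨(a, b, c), Finset.mem_univ _, rfl⟩))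
  simp only at this
  linarith

theorem link_arr [Fintype α] {x0 : ℝ} (hx : ∀ a b c, x0 < F.T a b c) (a : α) (V : Finset α)
    (hV : ∀ b ∈ V, F.prec a b) : Arr V (fun b => F.phi a b x0) (F.phi a) (F.T a) where
  kinj := by
    intro b hb c hc h
    by_contra hbc
    rcases F.link_cross (hV b hb) (hV c hc) hbc with g | g
    · have := (g x0).1.2 (hx a b c)
      linarith
    · have := (g x0).2.2 (hx a b c)
      linarith
  lt_iff := by
    intro b hb c hc h x
    have hbc : b ≠ c := by rintro rfl; exact lt_irrefl _ h
    rcases F.link_cross (hV b hb) (hV c hc) hbc with g | g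
    · exact (g x).1
    · have := (g x0).1.1 h
      exact absurd this (hx a b c).not_gt
  gt_iff := by
    intro b hb c hc h x
    have hbc : b ≠ c := by rintro rfl; exact lt_irrefl _ h
    rcases F.link_cross (hV b hb) (hV c hc) hbc with g | g
    · exact (g x).2
    · have := (g x0).1.1 h
      exact absurd this (hx a b c).not_gt
  conc := by
    intro b hb c hc d hd h1 h2 h3 x e1 e2
    have q1 := F.s_phi (hV b hb).1 x
    have q2 := F.s_phi (hV c hc).1 x
    have q3 := F.s_phi (hV d hd).1 x
    rw [← e1] at q2
    rw [← e2] at q3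
    exact F.four a b c d (hV b hb).1 (hV c hc).1 (hV d hd).1 h1 h2 h3 x _ q1 q2 q3

/-- edges of the link -/
def E [Fintype α] (k : ℕ) (x0 : ℝ) (a : α) : Finset (α × α) :=
  Finset.univ.filter fun p => F.prec a p.1 ∧ F.prec a p.2 ∧ F.phi a p.1 x0 < F.phi a p.2 x0 ∧
    F.Vk k {a, p.1, p.2}

def V [Fintype α] (k : ℕ) (a : α) : Finset α :=
  Finset.univ.filter fun b => F.prec a b ∧ (a, b) ∈ F.Act k

def Dm [Fintype α] (k : ℕ) (x0 : ℝ) (a : α) : Finset ((α × α) × (α × α)) :=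
  ((F.E k x0 a) ×ˢ (F.E k x0 a)).filter fun m => Dia (F.phi a) (F.T a) m.1.1 m.1.2 m.2.1 m.2.2

theorem mem_E [Fintype α] {k : ℕ} {x0 : ℝ} {a b c : α} : (b, c) ∈ F.E k x0 a ↔
    F.prec a b ∧ F.prec a c ∧ F.phi a b x0 < F.phi a c x0 ∧ F.Vk k {a, b, c} := by
  unfold E; rw [Finset.mem_filter]; simp

theorem E_ne [Fintype α] {k : ℕ} {x0 : ℝ} {a b c : α} (h : (b, c) ∈ F.E k x0 a) : b ≠ c := by
  rintro rfl
  exact lt_irrefl _ (F.mem_E.1 h).2.2.1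

theorem perm3 {a b c a' b' c' : α}
    (he : ∀ x, (x = a ∨ x = b ∨ x = c) ↔ (x = a' ∨ x = b' ∨ x = c')) :
    ({a, b, c} : Finset α) = {a', b', c'} := by
  ext x; simp only [Finset.mem_insert, Finset.mem_singleton]; exact he x

theorem E_V [Fintype α] {k : ℕ} {x0 : ℝ} {a b c : α} (h : (b, c) ∈ F.E k x0 a) :
    b ∈ F.V k a ∧ c ∈ F.V k a := by
  obtain ⟨h1, h2, h3, h4⟩ := F.mem_E.1 h
  constructor
  · refine Finset.mem_filter.2 ⟨Finset.mem_univ _, h1, Finset.mem_filter.2 ⟨Finset.mem_univ _, h1.1, c, ?_⟩⟩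
    rw [show ({c, (a, b).1, (a, b).2} : Finset α) = {a, b, c} from perm3 (by intro x; simp only; tauto)]
    exact h4
  · refine Finset.mem_filter.2 ⟨Finset.mem_univ _, h2, Finset.mem_filter.2 ⟨Finset.mem_univ _, h2.1, b, ?_⟩⟩
    rw [show ({b, (a, c).1, (a, c).2} : Finset α) = {a, b, c} from perm3 (by intro x; simp only; tauto)]
    exact h4

theorem sum_V [Fintype α] (k : ℕ) : ∑ a, (F.V k a).card ≤ (F.Act k).card := by
  rw [Finset.card_eq_sum_card_fiberwise (s := F.Act k) (t := Finset.univ) (f := Prod.fst)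
    (by intro x _; simp)]
  apply Finset.sum_le_sum
  intro a _
  apply Finset.card_le_card_of_injOn (fun b => (a, b))
  · intro b hb
    have := (Finset.mem_filter.1 hb).2.2
    simpa using this
  · intro b _ c _ h
    simpa using h

theorem sum_E [Fintype α] (k : ℕ) {x0 : ℝ} (hx : ∀ a b c, x0 < F.T a b c) :
    (Finset.univ.filter fun S : Finset α => S.card = 3 ∧ F.Vk k S).card ≤
      ∑ a, (F.E k x0 a).card := by
  have hsub : (Finset.univ.filter fun S : Finset α => S.card = 3 ∧ F.Vk k S) ⊆
      Finset.univ.biUnion (fun a => (F.E k x0 a).image fun p => ({a, p.1, p.2} : Finset α)) := by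
    intro S hS
    obtain ⟨-, h3, hV⟩ := Finset.mem_filter.1 hS
    obtain ⟨b, c, r, hbc, hbr, hcr, rfl⟩ := Finset.card_eq_three.1 h3
    obtain ⟨a', b', c', h1, h2, he⟩ := F.sort3 hbc hbr hcr
    have h13 := F.prec_trans h1 h2
    rw [Finset.mem_biUnion]
    refine ⟨a', Finset.mem_univ _, ?_⟩
    rw [Finset.mem_image]
    rw [← he] at hV ⊢
    have ar := F.link_arr hx a' {b', c'} (by
      intro u hu
      simp only [Finset.mem_insert, Finset.mem_singleton] at hu
      rcases hu with rfl | rfl <;> assumption)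
    rcases lt_trichotomy (F.phi a' b' x0) (F.phi a' c' x0) with g | g | g
    · exact ⟨(b', c'), F.mem_E.2 ⟨h1, h13, g, hV⟩, rfl⟩
    · exact absurd (ar.kinj b' (by simp) c' (by simp) g) h2.1
    · have e : ({a', c', b'} : Finset α) = {a', b', c'} := perm3 (by tauto)
      exact ⟨(c', b'), F.mem_E.2 ⟨h13, h1, g, by rw [e]; exact hV⟩, e⟩
  refine (Finset.card_le_card hsub).trans (Finset.card_biUnion_le.trans ?_)
  exact Finset.sum_le_sum fun a _ => Finset.card_image_le

theorem set_inj {x0 : ℝ} {a d e a' d' e' : α} (h1 : F.prec a d) (h2 : F.prec a e)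
    (h3 : F.phi a d x0 < F.phi a e x0) (h1' : F.prec a' d') (h2' : F.prec a' e')
    (h3' : F.phi a' d' x0 < F.phi a' e' x0) (h : ({a, d, e} : Finset α) = {a', d', e'}) :
    a = a' ∧ d = d' ∧ e = e' := by
  have hm : ∀ x, (x = a ∨ x = d ∨ x = e) ↔ (x = a' ∨ x = d' ∨ x = e') := by
    intro x
    have : x ∈ ({a, d, e} : Finset α) ↔ x ∈ ({a', d', e'} : Finset α) := by rw [h]
    simpa only [Finset.mem_insert, Finset.mem_singleton] using this
  have haa : a = a' := by
    by_contra hne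
    have g1 : F.prec a' a := by
      rcases (hm a).1 (Or.inl rfl) with g | g | g
      · exact absurd g hne
      · rw [g]; exact h1'
      · rw [g]; exact h2'
    have g2 : F.prec a a' := by
      rcases (hm a').2 (Or.inl rfl) with g | g | g
      · exact absurd g.symm hne
      · rw [g]; exact h1
      · rw [g]; exact h2
    exact F.prec_asymm g1 g2
  subst haa
  have hd := (hm d).1 (Or.inr (Or.inl rfl))
  have he := (hm e).1 (Or.inr (Or.inr rfl))
  refine ⟨rfl, ?_⟩
  rcases hd with g | g | g
  · exact absurd g.symm h1.1
  · subst g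
    rcases he with g' | g' | g'
    · exact absurd g'.symm h2.1
    · subst g'; exact absurd h3 (lt_irrefl _)
    · exact ⟨rfl, g'⟩
  · subst g
    rcases he with g' | g' | g'
    · exact absurd g'.symm h2.1
    · subst g'; exact absurd h3 h3'.not_gt
    · subst g'; exact absurd h3 (lt_irrefl _)

/-- pairs (curve, alternating vertex) -/
def R [Fintype α] (k : ℕ) : Finset ((α × α) × Finset α) :=
  ((F.Act k) ×ˢ Finset.univ).filter fun r => F.Alt r.1.1 r.1.2 r.2 ∧ F.Vk k r.2

theorem R_bound [Fintype α] (k : ℕ) (hk : 1 ≤ k) :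
    ((F.R k).card : ℝ) ≤ (F.Act k).card * (432 * (k : ℝ) ^ 2) := by
  rw [Finset.card_eq_sum_card_fiberwise (s := F.R k) (t := F.Act k) (f := Prod.fst)
    (by
      intro x hx
      exact (Finset.mem_product.1 (Finset.mem_filter.1 hx).1).1)]
  push_cast
  rw [← nsmul_eq_mul]
  apply Finset.sum_le_card_nsmul
  intro q hq
  refine le_trans ?_ (F.lovasz (b := q.1) (c := q.2) (Finset.mem_filter.1 hq).2.1 k hk)
  norm_cast
  apply Finset.card_le_card_of_injOn (fun r => r.2)
  · intro r hr
    obtain ⟨h1, h2⟩ := Finset.mem_filter.1 hr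
    obtain ⟨-, h3⟩ := Finset.mem_filter.1 h1
    subst h2
    exact Finset.mem_coe.2 (Finset.mem_filter.2 ⟨Finset.mem_univ _, h3⟩)
  · intro r hr r' hr' e
    have h2 := (Finset.mem_filter.1 hr).2
    have h2' := (Finset.mem_filter.1 hr').2
    exact Prod.ext (h2.trans h2'.symm) e

theorem E_Act [Fintype α] {k : ℕ} {x0 : ℝ} {a b c : α} (h : (b, c) ∈ F.E k x0 a) :
    (b, c) ∈ F.Act k :=
  Finset.mem_filter.2 ⟨Finset.mem_univ _, F.E_ne h, a, (F.mem_E.1 h).2.2.2⟩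

theorem dia_ne [Fintype α] {k : ℕ} {x0 : ℝ} {a b c d e : α}
    (h1 : (b, c) ∈ F.E k x0 a) (h : Dia (F.phi a) (F.T a) b c d e) :
    b ≠ d ∧ b ≠ e ∧ c ≠ d ∧ c ≠ e := by
  obtain ⟨g1, g2, -, -⟩ := F.mem_E.1 h1
  have e1 := (F.phi_at g1.1 g2.1 (F.E_ne h1)).2
  have hD := h.1
  unfold Opp at hD
  refine ⟨?_, ?_, ?_, ?_⟩ <;> rintro rfl <;> rcases hD with g | g <;> linarith [g.1, g.2]

theorem sum_Dm [Fintype α] (k : ℕ) {x0 : ℝ} :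
    ∑ a, (F.Dm k x0 a).card ≤ 2 * (F.R k).card := by
  rw [← Finset.card_sigma]
  set D := Finset.univ.sigma (F.Dm k x0) with hD
  set D1 := D.filter (fun m => F.Alt m.2.1.1 m.2.1.2 {m.1, m.2.2.1, m.2.2.2}) with hD1
  set D2 := D.filter (fun m => ¬ F.Alt m.2.1.1 m.2.1.2 {m.1, m.2.2.1, m.2.2.2}) with hD2
  have hs := Finset.card_filter_add_card_filter_not (s := D)
    (fun m => F.Alt m.2.1.1 m.2.1.2 {m.1, m.2.2.1, m.2.2.2})
  rw [← hD1, ← hD2] at hs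
  have hmem : ∀ a b c d e, (⟨a, (b, c), (d, e)⟩ : Σ _ : α, (α × α) × (α × α)) ∈ D →
      (b, c) ∈ F.E k x0 a ∧ (d, e) ∈ F.E k x0 a ∧ Dia (F.phi a) (F.T a) b c d e := by
    intro a b c d e h
    have h1 := (Finset.mem_sigma.1 h).2
    obtain ⟨h2, h3⟩ := Finset.mem_filter.1 h1
    obtain ⟨h4, h5⟩ := Finset.mem_product.1 h2
    exact ⟨h4, h5, h3⟩
  have c1 : D1.card ≤ (F.R k).card := by
    apply Finset.card_le_card_of_injOn
      (fun m => (m.2.1, ({m.1, m.2.2.1, m.2.2.2} : Finset α)))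
    · rintro ⟨a, ⟨b, c⟩, ⟨d, e⟩⟩ hm
      obtain ⟨h1, h2⟩ := Finset.mem_filter.1 hm
      obtain ⟨h3, h4, -⟩ := hmem a b c d e h1
      exact Finset.mem_coe.2 (Finset.mem_filter.2 ⟨Finset.mem_product.2
        ⟨F.E_Act h3, Finset.mem_univ _⟩, h2, (F.mem_E.1 h4).2.2.2⟩)
    · rintro ⟨a, ⟨b, c⟩, ⟨d, e⟩⟩ hm ⟨a', ⟨b', c'⟩, ⟨d', e'⟩⟩ hm' he
      obtain ⟨-, h4, -⟩ := hmem _ _ _ _ _ (Finset.mem_filter.1 hm).1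
      obtain ⟨-, h4', -⟩ := hmem _ _ _ _ _ (Finset.mem_filter.1 hm').1
      obtain ⟨g1, g2, g3, -⟩ := F.mem_E.1 h4
      obtain ⟨g1', g2', g3', -⟩ := F.mem_E.1 h4'
      simp only [Prod.mk.injEq] at he
      obtain ⟨⟨rfl, rfl⟩, he⟩ := he
      obtain ⟨rfl, rfl, rfl⟩ := F.set_inj g1 g2 g3 g1' g2' g3' he
      rfl
  have c2 : D2.card ≤ (F.R k).card := by
    apply Finset.card_le_card_of_injOn
      (fun m => (m.2.2, ({m.1, m.2.1.1, m.2.1.2} : Finset α)))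
    · rintro ⟨a, ⟨b, c⟩, ⟨d, e⟩⟩ hm
      obtain ⟨h1, h2⟩ := Finset.mem_filter.1 hm
      obtain ⟨h3, h4, h5⟩ := hmem a b c d e h1
      obtain ⟨g1, g2, g3, g4⟩ := F.mem_E.1 h3
      obtain ⟨g1', g2', g3', g4'⟩ := F.mem_E.1 h4
      have n := F.dia_ne h3 h5
      have hA := (F.claimB g1 g2 g1' g2' (F.E_ne h3) n.1 n.2.1 n.2.2.1 n.2.2.2 (F.E_ne h4)
        h5).resolve_left h2
      exact Finset.mem_coe.2 (Finset.mem_filter.2 ⟨Finset.mem_product.2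
        ⟨F.E_Act h4, Finset.mem_univ _⟩, hA, g4⟩)
    · rintro ⟨a, ⟨b, c⟩, ⟨d, e⟩⟩ hm ⟨a', ⟨b', c'⟩, ⟨d', e'⟩⟩ hm' he
      obtain ⟨h4, -, -⟩ := hmem _ _ _ _ _ (Finset.mem_filter.1 hm).1
      obtain ⟨h4', -, -⟩ := hmem _ _ _ _ _ (Finset.mem_filter.1 hm').1
      obtain ⟨g1, g2, g3, -⟩ := F.mem_E.1 h4
      obtain ⟨g1', g2', g3', -⟩ := F.mem_E.1 h4'
      simp only [Prod.mk.injEq] at he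
      obtain ⟨⟨rfl, rfl⟩, he⟩ := he
      obtain ⟨rfl, rfl, rfl⟩ := F.set_inj g1 g2 g3 g1' g2' g3' he
      rfl
  omega

theorem amp_a [Fintype α] (k : ℕ) {x0 : ℝ} (hx : ∀ a b c, x0 < F.T a b c) (a : α)
    (p : ℝ) (hp0 : 0 < p) (hp1 : p ≤ 1) :
    p ^ 2 * (F.E k x0 a).card ≤ 4 * p * (F.V k a).card + p ^ 4 * (F.Dm k x0 a).card := by
  have ar := F.link_arr hx a (F.V k a) (fun b hb => (Finset.mem_filter.1 hb).2.1)
  refine ar.amplified (E := F.E k x0 a) ?_ p hp0 hp1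
  rintro ⟨b, c⟩ h
  exact ⟨(F.E_V h).1, (F.E_V h).2, (F.mem_E.1 h).2.2.1⟩

theorem main [Fintype α] (k : ℕ) (hk : 1 ≤ k) :
    ((Finset.univ.filter fun S : Finset α => S.card = 3 ∧ F.Vk k S).card : ℝ) ≤
      41664 * Fintype.card α * (k : ℝ) ^ ((5 : ℝ) / 3) := by
  obtain ⟨x0, hx⟩ := F.exists_left
  set t : ℝ := ((Finset.univ.filter fun S : Finset α => S.card = 3 ∧ F.Vk k S).card : ℝ) with ht
  have hk1 : (1 : ℝ) ≤ k := by exact_mod_cast hk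
  have hk0 : (0 : ℝ) < k := by linarith
  set n : ℝ := (Fintype.card α : ℝ) with hn
  have hn0 : 0 ≤ n := by positivity
  set q : ℝ := (k : ℝ) ^ ((1 : ℝ) / 3) with hq
  have hq1 : 1 ≤ q := Real.one_le_rpow hk1 (by norm_num)
  have hq0 : 0 < q := by linarith
  have hq3 : q ^ 3 = k := by
    rw [hq, ← Real.rpow_natCast, ← Real.rpow_mul hk0.le]; norm_num
  have hq5 : (k : ℝ) ^ ((5 : ℝ) / 3) = q ^ 5 := by
    rw [hq, ← Real.rpow_natCast, ← Real.rpow_mul hk0.le]; norm_num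
  rw [hq5]
  set p : ℝ := (q ^ 2)⁻¹ with hp
  have hp0 : 0 < p := by positivity
  have hp1 : p ≤ 1 := inv_le_one_of_one_le₀ (one_le_pow₀ hq1)
  have b1 : t ≤ ∑ a, ((F.E k x0 a).card : ℝ) := by
    rw [ht]; exact_mod_cast F.sum_E k hx
  have b2 : ∑ a, ((F.V k a).card : ℝ) ≤ 48 * n * k := by
    refine le_trans ?_ (F.act_bound k hk)
    exact_mod_cast F.sum_V k
  have b3 : ∑ a, ((F.Dm k x0 a).card : ℝ) ≤ 2 * (48 * n * k * (432 * (k : ℝ) ^ 2)) := by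
    have h1 : ∑ a, ((F.Dm k x0 a).card : ℝ) ≤ 2 * (F.R k).card := by
      exact_mod_cast F.sum_Dm k (x0 := x0)
    have h2 := F.R_bound k hk
    have h3 := mul_le_mul_of_nonneg_right (F.act_bound k hk)
      (show (0 : ℝ) ≤ 432 * (k : ℝ) ^ 2 by positivity)
    linarith
  have b4 : p ^ 2 * ∑ a, ((F.E k x0 a).card : ℝ) ≤
      4 * p * ∑ a, ((F.V k a).card : ℝ) + p ^ 4 * ∑ a, ((F.Dm k x0 a).card : ℝ) := by
    rw [Finset.mul_sum, Finset.mul_sum, Finset.mul_sum, ← Finset.sum_add_distrib]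
    exact Finset.sum_le_sum fun a _ => F.amp_a k hx a p hp0 hp1
  have b5 : p ^ 2 * t ≤ 4 * p * (48 * n * k) + p ^ 4 * (2 * (48 * n * k * (432 * (k : ℝ) ^ 2))) := by
    have h1 := mul_le_mul_of_nonneg_left b1 (show 0 ≤ p ^ 2 by positivity)
    have h2 := mul_le_mul_of_nonneg_left b2 (show 0 ≤ 4 * p by positivity)
    have h3 := mul_le_mul_of_nonneg_left b3 (show 0 ≤ p ^ 4 by positivity)
    linarith
  have h6 := mul_le_mul_of_nonneg_left b5 (show 0 ≤ q ^ 4 by positivity)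
  have hpq : p * q ^ 2 = 1 := by rw [hp]; field_simp
  rw [← hq3] at h6
  have l : q ^ 4 * (p ^ 2 * t) = t := by
    calc _ = (p * q ^ 2) ^ 2 * t := by ring
      _ = t := by rw [hpq]; ring
  have r : q ^ 4 * (4 * p * (48 * n * q ^ 3) +
      p ^ 4 * (2 * (48 * n * q ^ 3 * (432 * (q ^ 3) ^ 2)))) = 41664 * n * q ^ 5 := by
    calc _ = (p * q ^ 2) * (192 * n * q ^ 5) + (p * q ^ 2) ^ 4 * (41472 * n * q ^ 5) := by ring
      _ = _ := by rw [hpq]; ring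
  linarith

end Fam
end PPk

namespace PPk

theorem exists_fam (Λ : Finset PP) (h : PseudoplaneFamily Λ) :
    ∃ F : Fam Λ, ∀ a : Λ, F.s a = a.1 := by
  obtain ⟨h1, h2, h3, h4, h5, h6, h7⟩ := h
  have hg : ∀ a b : Λ, ∃ φ : ℝ → ℝ, a ≠ b → IsGraphFun a.1 b.1 φ := by
    intro a b
    by_cases hab : a = b
    · exact ⟨fun _ => 0, fun hh => absurd hab hh⟩
    · obtain ⟨φ, hφ⟩ := h2 a.1 a.2 b.1 b.2 (fun e => hab (Subtype.ext e))
      exact ⟨φ, fun _ => hφ⟩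
  choose phi hphi using hg
  have ne : ∀ {a b : Λ}, a ≠ b → a.1 ≠ b.1 := fun hab e => hab (Subtype.ext e)
  refine ⟨{ s := fun a => a.1, phi := phi, s_cont := fun a => h1 a.1 a.2,
            phi_cont := fun a b hab => (hphi a b hab).1,
            phi_iff := fun a b hab => (hphi a b hab).2,
            tri := fun a b c hab hac hbc =>
              h3 a.1 a.2 b.1 b.2 c.1 c.2 (ne hab) (ne hac) (ne hbc),
            cross := ?_,
            four := fun a b c d hab hac had hbc hbd hcd x y e1 e2 e3 =>
              h5 a.1 a.2 b.1 b.2 c.1 c.2 d.1 d.2 (ne hab) (ne hac) (ne had) (ne hbc) (ne hbd)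
                (ne hcd) ⟨x, y, e1, e2, e3⟩,
            two := fun a b hab => (h6 a.1 a.2 b.1 b.2 (ne hab)).1,
            three := fun a b c hab hac hbc =>
              h7 a.1 a.2 b.1 b.2 c.1 c.2 (ne hab) (ne hac) (ne hbc) _ (hphi a b hab) },
          fun a => rfl⟩
  intro a b c d hab hcd hac had hbc hbd
  refine h4 a.1 a.2 b.1 b.2 c.1 c.2 d.1 d.2 (ne hab) (ne hcd) ?_ _ _ (hphi a b hab) (hphi c d hcd)
  intro e
  have : a.1 ∈ ({c.1, d.1} : Finset PP) := by rw [← e]; simp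
  simp only [Finset.mem_insert, Finset.mem_singleton] at this
  rcases this with g | g
  · exact ne hac g
  · exact ne had g

theorem corridors_le (Λ : Finset PP) (F : Fam Λ) (hF : ∀ a : Λ, F.s a = a.1) (k : ℕ) :
    (kCorridors Λ k).card ≤
      (Finset.univ.filter fun S : Finset Λ => S.card = 3 ∧ F.Vk k S).card := by
  refine Finset.card_le_card_of_injOn (fun S => S.subtype (fun a => a ∈ Λ)) ?_ ?_
  · intro S hS
    obtain ⟨hS1, x, y, z, hz, hl⟩ := Finset.mem_filter.1 hS
    obtain ⟨hsub, hcard⟩ := Finset.mem_powersetCard.1 hS1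
    have hc : (S.subtype (fun a => a ∈ Λ)).card = S.card := by
      rw [Finset.card_subtype, Finset.filter_true_of_mem (fun a ha => hsub ha)]
    refine Finset.mem_coe.2 (Finset.mem_filter.2 ⟨Finset.mem_univ _, hc.trans hcard, x, y, z, ?_, ?_⟩)
    · intro a ha
      rw [hF]
      exact hz a.1 (Finset.mem_subtype.1 ha)
    · rw [← hl]
      unfold level
      apply Finset.card_bij (fun (a : Λ) _ => a.1)
      · intro a ha
        have := (Finset.mem_filter.1 ha).2
        rw [hF] at this
        exact Finset.mem_filter.2 ⟨a.2, this⟩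
      · intro a _ b _ e
        exact Subtype.ext e
      · intro b hb
        obtain ⟨hb1, hb2⟩ := Finset.mem_filter.1 hb
        exact ⟨⟨b, hb1⟩, Finset.mem_filter.2 ⟨Finset.mem_univ _, by rw [hF]; exact hb2⟩, rfl⟩
  · intro S hS S' hS' e
    have m1 := (Finset.mem_powersetCard.1 (Finset.mem_filter.1 hS).1).1
    have m2 := (Finset.mem_powersetCard.1 (Finset.mem_filter.1 hS').1).1
    simp only at e
    ext a
    constructor
    · intro ha
      have : (⟨a, m1 ha⟩ : Λ) ∈ S.subtype (fun a => a ∈ Λ) := Finset.mem_subtype.2 ha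
      rw [e] at this
      exact Finset.mem_subtype.1 this
    · intro ha
      have : (⟨a, m2 ha⟩ : Λ) ∈ S'.subtype (fun a => a ∈ Λ) := Finset.mem_subtype.2 ha
      rw [← e] at this
      exact Finset.mem_subtype.1 this

end PPk

/-- There is an absolute constant `C` such that for every family `Λ` of `n`
pseudoplanes in general position in ℝ³ and every integer `k` with `1 ≤ k < n`, the number of
vertices of the arrangement at level `k` (equivalently, the number `|C^k|` of `k`-corridors)
is at most `C · n · k^{5/3}`. -/
theorem statement0 :
    ∃ C : ℝ, 0 < C ∧
      ∀ (Λ : Finset PP) (n k : ℕ), Λ.card = n → PseudoplaneFamily Λ →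
        1 ≤ k → k < n →
        ((kCorridors Λ k).card : ℝ) ≤ C * (n : ℝ) * (k : ℝ) ^ ((5 : ℝ) / 3) := by
  refine ⟨41664, by norm_num, ?_⟩
  intro Λ n k hn hΛ hk _
  obtain ⟨F, hF⟩ := PPk.exists_fam Λ hΛ
  have h1 := F.main k hk
  have h2 : ((kCorridors Λ k).card : ℝ) ≤ _ := Nat.cast_le.2 (PPk.corridors_le Λ F hF k)
  rw [Fintype.card_coe, hn] at h1
  exact h2.trans h1
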